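/- For every a > 0, the set S_a spans a finite-dimensional real vector space: there exist finitely many functions v₁,…,v_m : (−∞,0] × ℝ → ℝ such that every u ∈ S_a is a real linear combination of v₁,…,v_m. -/

import Mathlib

open Filter Set

/-- The integral of `g` against the tent function of radius `r` centred at `c`. -/
noncomputable def tentIntegral (r : ℝ) (g : ℝ → ℝ) (c : ℝ) : ℝ :=
  ∫ y in (0 : ℝ)..r, (r - y) * (g (c + y) + g (c - y))

/-- The symmetric second difference of `g` at `c` with step `r`. -/
def secondDiff (r : ℝ) (g : ℝ → ℝ) (c : ℝ) : ℝ :=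
  g (c + r) - 2 * g c + g (c - r)

theorem intervalIntegrable_tent {g : ℝ → ℝ} (hg : Continuous g) (r c : ℝ) :
    IntervalIntegrable (fun y => (r - y) * (g (c + y) + g (c - y))) MeasureTheory.volume 0 r :=
  Continuous.intervalIntegrable (by fun_prop) _ _

theorem tentIntegral_deriv_deriv {g g' g'' : ℝ → ℝ} (hg : ∀ x, HasDerivAt g (g' x) x)
    (hg' : ∀ x, HasDerivAt g' (g'' x) x) (hc : Continuous g'') (r c : ℝ) :
    tentIntegral r g'' c = secondDiff r g c := by
  have key : ∀ y : ℝ, HasDerivAt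
      (fun y => (r - y) * (g' (c + y) - g' (c - y)) + (g (c + y) + g (c - y)))
      ((r - y) * (g'' (c + y) + g'' (c - y))) y := by
    intro y
    have hp : HasDerivAt (fun y : ℝ => c + y) 1 y := by
      simpa using (hasDerivAt_id y).const_add c
    have hm : HasDerivAt (fun y : ℝ => c - y) (-1) y := by
      simpa using (hasDerivAt_id y).const_sub c
    have hr : HasDerivAt (fun y : ℝ => r - y) (-1) y := by
      simpa using (hasDerivAt_id y).const_sub r
    have h := (hr.mul (((hg' (c + y)).comp y hp).sub ((hg' (c - y)).comp y hm))).add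
      (((hg (c + y)).comp y hp).add ((hg (c - y)).comp y hm))
    refine h.congr_deriv ?_
    simp only [Function.comp_apply, Pi.sub_apply]
    ring
  rw [tentIntegral, intervalIntegral.integral_eq_sub_of_hasDerivAt (fun y _ => key y)
    (intervalIntegrable_tent hc r c), secondDiff]
  simp
  ring

theorem tentIntegral_mono {g h : ℝ → ℝ} (hg : Continuous g) (hh : Continuous h) {r c : ℝ}
    (hr : 0 ≤ r) (hgh : ∀ x ∈ Icc (c - r) (c + r), g x ≤ h x) :
    tentIntegral r g c ≤ tentIntegral r h c := by
  refine intervalIntegral.integral_mono_on hr (intervalIntegrable_tent hg r c)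
    (intervalIntegrable_tent hh r c) fun y hy => ?_
  have h1 := hgh (c + y) ⟨by linarith [hy.1], by linarith [hy.2]⟩
  have h2 := hgh (c - y) ⟨by linarith [hy.2], by linarith [hy.1]⟩
  exact mul_le_mul_of_nonneg_left (by linarith) (by linarith [hy.2])

theorem tentIntegral_const (r m c : ℝ) : tentIntegral r (fun _ => m) c = m * r ^ 2 := by
  have h1 : ∀ x : ℝ, HasDerivAt (fun x : ℝ => m / 2 * x ^ 2) (m * x) x := fun x =>
    ((hasDerivAt_pow 2 x).const_mul (m / 2)).congr_deriv (by simp; ring)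
  have h2 : ∀ x : ℝ, HasDerivAt (fun x : ℝ => m * x) m x := fun x => by
    simpa using (hasDerivAt_id x).const_mul m
  rw [tentIntegral_deriv_deriv h1 h2 continuous_const, secondDiff]
  ring

theorem abs_tentIntegral_le {g : ℝ → ℝ} (hg : Continuous g) {r c m : ℝ} (hr : 0 ≤ r)
    (hm : ∀ x ∈ Icc (c - r) (c + r), |g x| ≤ m) : |tentIntegral r g c| ≤ m * r ^ 2 := by
  rw [abs_le]
  constructor
  · rw [← neg_mul, ← tentIntegral_const r (-m) c]
    exact tentIntegral_mono continuous_const hg hr fun x hx => (abs_le.1 (hm x hx)).1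
  · rw [← tentIntegral_const r m c]
    exact tentIntegral_mono hg continuous_const hr fun x hx => (abs_le.1 (hm x hx)).2

theorem tentIntegral_sub {g h : ℝ → ℝ} (hg : Continuous g) (hh : Continuous h) (r c : ℝ) :
    tentIntegral r (fun x => g x - h x) c = tentIntegral r g c - tentIntegral r h c := by
  rw [tentIntegral, tentIntegral, tentIntegral, ← intervalIntegral.integral_sub
    (intervalIntegrable_tent hg r c) (intervalIntegrable_tent hh r c)]
  congr 1
  ext y
  ring

theorem tentIntegral_const_mul (k : ℝ) (g : ℝ → ℝ) (r c : ℝ) :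
    tentIntegral r (fun x => k * g x) c = k * tentIntegral r g c := by
  rw [tentIntegral, tentIntegral, ← intervalIntegral.integral_const_mul]
  congr 1
  ext y
  ring

theorem tendsto_tentIntegral_div {g : ℝ → ℝ} (hg : Continuous g) (c : ℝ) :
    Tendsto (fun r => tentIntegral r g c / r ^ 2) (nhdsWithin 0 (Ioi 0)) (nhds (g c)) := by
  rw [Metric.tendsto_nhdsWithin_nhds]
  intro ε hε
  obtain ⟨δ, hδ, h⟩ := Metric.continuous_iff.1 hg c (ε / 2) (by positivity)
  refine ⟨δ, hδ, fun r hr hrδ => ?_⟩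
  have hr0 : 0 < r := hr
  rw [Real.dist_eq, sub_zero, abs_of_pos hr0] at hrδ
  have h1 := abs_tentIntegral_le (g := fun x => g x - g c) (by fun_prop) (c := c) hr0.le
    (m := ε / 2) fun x hx => by
      have := h x (by rw [Real.dist_eq, abs_lt]; constructor <;> linarith [hx.1, hx.2])
      rw [Real.dist_eq] at this
      exact this.le
  rw [tentIntegral_sub hg continuous_const, tentIntegral_const] at h1
  have hr2 : 0 < r ^ 2 := by positivity
  rw [Real.dist_eq, show tentIntegral r g c / r ^ 2 - g c
    = (tentIntegral r g c - g c * r ^ 2) / r ^ 2 by field_simp, abs_div, abs_of_pos hr2,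
    div_lt_iff₀ hr2]
  nlinarith

theorem tendsto_secondDiff_div {g g' g'' : ℝ → ℝ} (hg : ∀ x, HasDerivAt g (g' x) x)
    (hg' : ∀ x, HasDerivAt g' (g'' x) x) (hc : Continuous g'') (c : ℝ) :
    Tendsto (fun r => secondDiff r g c / r ^ 2) (nhdsWithin 0 (Ioi 0)) (nhds (g'' c)) := by
  simpa only [tentIntegral_deriv_deriv hg hg' hc] using tendsto_tentIntegral_div hc c

theorem second_deriv_nonpos_of_isLocalMax {g g' g'' : ℝ → ℝ} (hg : ∀ x, HasDerivAt g (g' x) x)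
    (hg' : ∀ x, HasDerivAt g' (g'' x) x) (hc : Continuous g'') {c : ℝ} (hmax : IsLocalMax g c) :
    g'' c ≤ 0 := by
  refine le_of_tendsto (tendsto_secondDiff_div hg hg' hc c) ?_
  have hp : Tendsto (fun r : ℝ => c + r) (nhdsWithin 0 (Ioi 0)) (nhds c) := by
    have : Tendsto (fun r : ℝ => c + r) (nhds 0) (nhds (c + 0)) :=
      Continuous.tendsto (by fun_prop) _
    rw [add_zero] at this
    exact this.mono_left nhdsWithin_le_nhds
  have hm : Tendsto (fun r : ℝ => c - r) (nhdsWithin 0 (Ioi 0)) (nhds c) := by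
    have : Tendsto (fun r : ℝ => c - r) (nhds 0) (nhds (c - 0)) :=
      Continuous.tendsto (by fun_prop) _
    rw [sub_zero] at this
    exact this.mono_left nhdsWithin_le_nhds
  filter_upwards [hp.eventually hmax, hm.eventually hmax] with r h1 h2
  refine div_nonpos_of_nonpos_of_nonneg ?_ (by positivity)
  rw [secondDiff]
  linarith

theorem exists_second_antideriv {g : ℝ → ℝ} (hg : Continuous g) :
    ∃ G G' : ℝ → ℝ, (∀ x, HasDerivAt G (G' x) x) ∧ ∀ x, HasDerivAt G' (g x) x := by
  have h' : ∀ x, HasDerivAt (fun x => ∫ y in (0 : ℝ)..x, g y) (g x) x := fun x =>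
    intervalIntegral.integral_hasDerivAt_right (hg.intervalIntegrable _ _)
      (hg.stronglyMeasurableAtFilter _ _) hg.continuousAt
  have hc : Continuous (fun x => ∫ y in (0 : ℝ)..x, g y) :=
    continuous_iff_continuousAt.2 fun x => (h' x).continuousAt
  exact ⟨fun x => ∫ z in (0 : ℝ)..x, ∫ y in (0 : ℝ)..z, g y, _, fun x =>
    intervalIntegral.integral_hasDerivAt_right (hc.intervalIntegrable _ _)
      (hc.stronglyMeasurableAtFilter _ _) hc.continuousAt, h'⟩

theorem hasDerivAt_secondDiff {g g' : ℝ → ℝ} (hg : ∀ x, HasDerivAt g (g' x) x) (r x : ℝ) :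
    HasDerivAt (secondDiff r g) (secondDiff r g' x) x := by
  have hp : HasDerivAt (fun y : ℝ => g (y + r)) (g' (x + r)) x :=
    (hg (x + r)).comp_add_const x r
  have hm : HasDerivAt (fun y : ℝ => g (y - r)) (g' (x - r)) x :=
    (hg (x - r)).comp_sub_const x r
  exact (hp.sub ((hg x).const_mul 2)).add hm

/-- The tent average of a continuous bounded function is twice differentiable, with an explicit
second derivative and an explicit bound on the first one. -/
theorem exists_deriv_tentIntegral {g : ℝ → ℝ} (hg : Continuous g) {m : ℝ} (hm : ∀ x, |g x| ≤ m)
    {r : ℝ} (hr : 0 ≤ r) :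
    ∃ d : ℝ → ℝ, (∀ x, HasDerivAt (tentIntegral r g) (d x) x) ∧
      (∀ x, HasDerivAt d (secondDiff r g x) x) ∧ ∀ x, |d x| ≤ 2 * m * r := by
  obtain ⟨G, G', hG, hG'⟩ := exists_second_antideriv hg
  have e : tentIntegral r g = secondDiff r G :=
    funext fun x => tentIntegral_deriv_deriv hG hG' hg r x
  refine ⟨secondDiff r G', fun x => e ▸ hasDerivAt_secondDiff hG r x,
    fun x => hasDerivAt_secondDiff hG' r x, fun x => ?_⟩
  have lip : ∀ y z, |G' y - G' z| ≤ m * |y - z| := fun y z => by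
    have := Convex.norm_image_sub_le_of_norm_hasDerivWithin_le (f := G') (f' := g) (s := univ)
      (C := m) (x := z) (y := y) (fun x _ => (hG' x).hasDerivWithinAt) (fun x _ => hm x)
      convex_univ (mem_univ _) (mem_univ _)
    simpa using this
  have h1 := lip (x + r) x
  have h2 := lip x (x - r)
  rw [show x + r - x = r by ring, abs_of_nonneg hr] at h1
  rw [show x - (x - r) = r by ring, abs_of_nonneg hr] at h2
  rw [secondDiff]
  rw [abs_le] at *
  constructor <;> linarith [h1.1, h1.2, h2.1, h2.2]

/-- A continuous function whose second differences are the tent integrals of a continuous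
function `q` has second derivative `q`. -/
theorem exists_deriv_of_secondDiff {g q : ℝ → ℝ} (hg : Continuous g) (hq : Continuous q)
    (h : ∀ c r, 0 < r → secondDiff r g c = tentIntegral r q c) :
    ∃ g' : ℝ → ℝ, (∀ x, HasDerivAt g (g' x) x) ∧ ∀ x, HasDerivAt g' (q x) x := by
  obtain ⟨G, G', hG, hG'⟩ := exists_second_antideriv hq
  have hGc : Continuous G := continuous_iff_continuousAt.2 fun x => (hG x).continuousAt
  set d : ℝ → ℝ := fun x => g x - G x - (g 0 - G 0) with hd
  have hdc : Continuous d := by fun_prop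
  have mid : ∀ c r, d (c + r) + d (c - r) = 2 * d c := by
    have pos : ∀ c r, 0 < r → d (c + r) + d (c - r) = 2 * d c := by
      intro c r hr
      have := h c r hr
      rw [tentIntegral_deriv_deriv hG hG' hq, secondDiff, secondDiff] at this
      simp only [hd]
      linarith
    intro c r
    rcases lt_trichotomy r 0 with hr | hr | hr
    · have := pos c (-r) (by linarith)
      rw [← sub_eq_add_neg, sub_neg_eq_add] at this
      linarith
    · subst hr; simp; ring
    · exact pos c r hr
  have d0 : d 0 = 0 := by simp [hd]
  have dadd : ∀ x y, d (x + y) = d x + d y := by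
    intro x y
    have h1 := mid ((x + y) / 2) ((x - y) / 2)
    rw [show (x + y) / 2 + (x - y) / 2 = x by ring,
      show (x + y) / 2 - (x - y) / 2 = y by ring] at h1
    have h2 := mid ((x + y) / 2) ((x + y) / 2)
    rw [show (x + y) / 2 + (x + y) / 2 = x + y by ring, sub_self, d0] at h2
    linarith
  let D : ℝ →+ ℝ := ⟨⟨d, d0⟩, dadd⟩
  have lin : ∀ x, d x = x * d 1 := fun x => by
    simpa [D] using map_real_smul D hdc x 1
  refine ⟨fun x => G' x + d 1, fun x => ?_, fun x => (hG' x).add_const _⟩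
  have e : g = fun x => G x + x * d 1 + (g 0 - G 0) := by
    ext x
    rw [← lin x]
    simp only [hd]
    ring
  rw [e]
  have := ((hG x).add ((hasDerivAt_id x).mul_const (d 1))).add_const (g 0 - G 0)
  simpa using this

/-- A maximum principle on a rectangle: a continuous function that is nonpositive on the parabolic
boundary, and decreasing in time at each interior positive spatial maximum, is nonpositive. -/
theorem nonpos_of_parabolic_boundary {v : ℝ → ℝ → ℝ} (hv : Continuous (Function.uncurry v))
    {t₀ t₁ c d : ℝ} (hinit : ∀ x ∈ Icc c d, v t₀ x ≤ 0) (hleft : ∀ t ∈ Icc t₀ t₁, v t c ≤ 0)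
    (hright : ∀ t ∈ Icc t₀ t₁, v t d ≤ 0)
    (hmax : ∀ t ∈ Ioc t₀ t₁, ∀ x ∈ Ioo c d, 0 < v t x → IsLocalMax (v t) x →
      ∃ v' < 0, HasDerivAt (fun s => v s x) v' t) :
    ∀ t ∈ Icc t₀ t₁, ∀ x ∈ Icc c d, v t x ≤ 0 := by
  intro t ht x hx
  obtain ⟨⟨τ, ξ⟩, ⟨hτ, hξ⟩, hM⟩ := (isCompact_Icc.prod isCompact_Icc).exists_isMaxOn
    (⟨(t, x), ht, hx⟩ : (Icc t₀ t₁ ×ˢ Icc c d).Nonempty) hv.continuousOn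
  have hM' : ∀ s ∈ Icc t₀ t₁, ∀ y ∈ Icc c d, v s y ≤ v τ ξ := fun s hs y hy =>
    hM (show (s, y) ∈ Icc t₀ t₁ ×ˢ Icc c d from ⟨hs, hy⟩)
  refine (hM' t ht x hx).trans ?_
  by_contra! hpos
  simp only at hτ hξ
  have h1 : t₀ < τ := lt_of_le_of_ne hτ.1 fun h => by
    subst h; exact absurd (hinit ξ hξ) hpos.not_ge
  have h2 : c < ξ := lt_of_le_of_ne hξ.1 fun h => by
    subst h; exact absurd (hleft τ hτ) hpos.not_ge
  have h3 : ξ < d := lt_of_le_of_ne hξ.2 fun h => by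
    subst h; exact absurd (hright τ hτ) hpos.not_ge
  have hloc : IsLocalMax (v τ) ξ := by
    filter_upwards [Ioo_mem_nhds h2 h3] with y hy
    exact hM' τ hτ y ⟨hy.1.le, hy.2.le⟩
  obtain ⟨v', hv', hder⟩ := hmax τ ⟨h1, hτ.2⟩ ξ ⟨h2, h3⟩ hpos hloc
  have hslope := (hasDerivAt_iff_tendsto_slope_left_right.1 hder).1.eventually (gt_mem_nhds hv')
  obtain ⟨s, hs, hs1, hs2⟩ := (hslope.and (Ioo_mem_nhdsLT h1)).exists
  rw [slope_def_field] at hs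
  have hneg : s - τ < 0 := by linarith
  have : 0 < v s ξ - v τ ξ := by
    rcases div_neg_iff.1 hs with h | h
    · exact h.1
    · linarith [h.2]
  linarith [hM' s ⟨hs1.le, hs2.le.trans hτ.2⟩ ξ hξ]

/-- A pointwise solution of `∂u/∂t = ∂²u/∂x² - V u` for negative times. -/
structure IsPointwiseSolution (V : ℝ → ℝ) (u ux uxx : ℝ → ℝ → ℝ) : Prop where
  continuous_time : ∀ x, Continuous fun t => u t x
  hasDerivAt_space : ∀ t x, HasDerivAt (u t) (ux t x) x
  hasDerivAt_space' : ∀ t x, HasDerivAt (ux t) (uxx t x) x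
  continuous_uxx : ∀ t, Continuous (uxx t)
  hasDerivAt_time : ∀ t < 0, ∀ x, HasDerivAt (fun s => u s x) (uxx t x - V x * u t x) t

theorem IsPointwiseSolution.continuous_space {V : ℝ → ℝ} {u ux uxx : ℝ → ℝ → ℝ}
    (h : IsPointwiseSolution V u ux uxx) (t : ℝ) : Continuous (u t) :=
  continuous_iff_continuousAt.2 fun x => (h.hasDerivAt_space t x).continuousAt

/-- The time derivative of the tent average of a solution, according to the weak form of the
equation. -/
noncomputable def weakRate (V : ℝ → ℝ) (u : ℝ → ℝ → ℝ) (r c t : ℝ) : ℝ :=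
  secondDiff r (u t) c - tentIntegral r (fun x => V x * u t x) c

/-- `u` satisfies at time `t` the weak form of the equation against all tents supported in `I`. -/
def HasWeakRate (V : ℝ → ℝ) (u : ℝ → ℝ → ℝ) (I : Set ℝ) (t : ℝ) : Prop :=
  ∀ c r, 0 < r → Icc (c - r) (c + r) ⊆ I →
    HasDerivAt (fun s => tentIntegral r (u s) c) (weakRate V u r c t) t

/-- The second differences of `g` inside `I` are bounded by those of `n x² / 2`. -/
def SecondDiffBound (I : Set ℝ) (n : ℝ) (g : ℝ → ℝ) : Prop :=
  ∀ c r, 0 < r → Icc (c - r) (c + r) ⊆ I → |secondDiff r g c| ≤ n * r ^ 2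

theorem continuous_tentIntegral_param {w : ℝ → ℝ → ℝ} (hx : ∀ t, Continuous (w t))
    (ht : ∀ x, Continuous fun t => w t x) {m : ℝ} (hm : ∀ t x, |w t x| ≤ m) (r c : ℝ) :
    Continuous fun t => tentIntegral r (w t) c := by
  refine intervalIntegral.continuous_of_dominated_interval (bound := fun y => |r - y| * (2 * m))
    (fun t => ?_) (fun t => ?_) ?_ ?_
  · have := hx t
    exact Continuous.aestronglyMeasurable (by fun_prop)
  · refine Eventually.of_forall fun y _ => ?_
    rw [Real.norm_eq_abs, abs_mul]
    refine mul_le_mul_of_nonneg_left ((abs_add_le _ _).trans ?_) (abs_nonneg _)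
    linarith [hm t (c + y), hm t (c - y)]
  · exact Continuous.intervalIntegrable (by fun_prop) _ _
  · refine Eventually.of_forall fun y _ => ?_
    have h1 := ht (c + y)
    have h2 := ht (c - y)
    fun_prop

theorem continuous_weakRate {V : ℝ → ℝ} {u ux uxx : ℝ → ℝ → ℝ}
    (h : IsPointwiseSolution V u ux uxx) (hV : Continuous V) {Λ M : ℝ} (hΛ : ∀ x, |V x| ≤ Λ)
    (hM : ∀ t x, |u t x| ≤ M) (r c : ℝ) : Continuous (weakRate V u r c) := by
  have h1 := h.continuous_time
  have h2 : Continuous fun t => tentIntegral r (fun x => V x * u t x) c := by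
    refine continuous_tentIntegral_param (fun t => hV.mul (h.continuous_space t))
      (fun x => continuous_const.mul (h1 x)) (m := Λ * M) (fun t x => ?_) r c
    change |V x * u t x| ≤ _
    rw [abs_mul]
    exact mul_le_mul (hΛ x) (hM t x) (abs_nonneg _) ((abs_nonneg _).trans (hΛ x))
  have h3 : Continuous fun t => secondDiff r (u t) c :=
    ((h1 (c + r)).sub (continuous_const.mul (h1 c))).add (h1 (c - r))
  exact h3.sub h2

theorem continuous_uncurry_tentIntegral {w : ℝ → ℝ → ℝ} (hx : ∀ t, Continuous (w t))
    (ht : ∀ x, Continuous fun t => w t x) {m : ℝ} (hm : ∀ t x, |w t x| ≤ m) {r : ℝ}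
    (hr : 0 ≤ r) : Continuous (Function.uncurry fun t x => tentIntegral r (w t) x) := by
  have hm0 : 0 ≤ m := (abs_nonneg _).trans (hm 0 0)
  refine continuous_prod_of_continuous_lipschitzWith' _ (Real.toNNReal (2 * m * r)) (fun t => ?_)
    fun x => continuous_tentIntegral_param hx ht hm r x
  obtain ⟨d, hd, -, hb⟩ := exists_deriv_tentIntegral (hx t) (hm t) hr
  refine LipschitzWith.of_dist_le_mul fun x y => ?_
  rw [Real.coe_toNNReal _ (by positivity), Real.dist_eq, Real.dist_eq]
  have := Convex.norm_image_sub_le_of_norm_hasDerivWithin_le (f' := d) (s := univ)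
      (C := 2 * m * r) (x := y) (y := x) (fun x _ => (hd x).hasDerivWithinAt) (fun x _ => hb x)
      convex_univ (mem_univ _) (mem_univ _)
  simpa using this

/-- Before the mollification is removed: growth of a tent average of a weak solution starting from
data with bounded second differences. -/
theorem tentIntegral_sub_le_of_hasWeakRate {V : ℝ → ℝ} {u ux uxx : ℝ → ℝ → ℝ}
    (h : IsPointwiseSolution V u ux uxx) (hV : Continuous V) {Λ M : ℝ} (hΛ : ∀ x, |V x| ≤ Λ)
    (hM : ∀ t x, |u t x| ≤ M) {I : Set ℝ} {α s n ρ x₀ ε e : ℝ} (hαs : α ≤ s) (hρ : 0 < ρ)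
    (he : |e| = 1) (hε : 0 < ε) (hερ : ε ≤ ρ) (hI : Icc (x₀ - 2 * ρ) (x₀ + 2 * ρ) ⊆ I)
    (hweak : ∀ t ∈ Ioc α s, HasWeakRate V u I t) (hα : SecondDiffBound I n (u α)) :
    e * (tentIntegral ε (u s) x₀ - tentIntegral ε (u α) x₀) / ε ^ 2
      ≤ (n + 4 * M / ρ ^ 2 + Λ * M + 1) * (s - α) := by
  have hM0 : 0 ≤ M := (abs_nonneg _).trans (hM 0 0)
  have hε2 : 0 < ε ^ 2 := by positivity
  have hρ2 : 0 < ρ ^ 2 := by positivity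
  set A : ℝ := 2 * M / ρ ^ 2 with hA
  have hAρ : A * ρ ^ 2 = 2 * M := by rw [hA]; field_simp
  have hA0 : 0 ≤ A := by positivity
  have hA2 : 4 * M / ρ ^ 2 = 2 * A := by rw [hA]; ring
  rw [hA2]
  set L : ℝ := n + 2 * A + Λ * M + 1 with hL
  set T : ℝ → ℝ → ℝ := fun t x => tentIntegral ε (u t) x with hT
  have hTc : Continuous (Function.uncurry T) :=
    continuous_uncurry_tentIntegral h.continuous_space h.continuous_time hM hε.le
  have hTb : ∀ t x, |T t x| ≤ M * ε ^ 2 := fun t x =>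
    abs_tentIntegral_le (h.continuous_space t) hε.le fun y _ => hM t y
  have hn : 0 ≤ n := by
    have h1 := (abs_nonneg _).trans
      (hα x₀ ρ hρ ((Icc_subset_Icc (by linarith) (by linarith)).trans hI))
    by_contra! hneg
    nlinarith
  have hΛ0 : 0 ≤ Λ := (abs_nonneg _).trans (hΛ 0)
  have hL0 : 0 ≤ L := by positivity
  set v : ℝ → ℝ → ℝ := fun t x =>
    e * (T t x - T α x) / ε ^ 2 - L * (t - α) - A * (x - x₀) ^ 2 with hv
  have hlat : ∀ t ∈ Icc α s, ∀ x, (x - x₀) ^ 2 = ρ ^ 2 → v t x ≤ 0 := by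
    intro t ht x hx
    have h1 : e * (T t x - T α x) ≤ 2 * M * ε ^ 2 := by
      refine (le_abs_self _).trans ?_
      rw [abs_mul, he, one_mul]
      refine (abs_sub _ _).trans ?_
      linarith [hTb t x, hTb α x]
    have h2 : e * (T t x - T α x) / ε ^ 2 ≤ 2 * M := by rwa [div_le_iff₀ hε2]
    have h3 : 0 ≤ L * (t - α) := mul_nonneg hL0 (by linarith [ht.1])
    simp only [hv, hx, hAρ]
    linarith
  have main := nonpos_of_parabolic_boundary (v := v) (t₀ := α) (t₁ := s) (c := x₀ - ρ)
    (d := x₀ + ρ) ?_ ?_ ?_ ?_ ?_ s ⟨hαs, le_rfl⟩ x₀ ⟨by linarith, by linarith⟩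
  · simp only [hv, sub_self] at main
    simp only [hT] at main
    linarith
  · have h1 : Continuous fun p : ℝ × ℝ => T p.1 p.2 := hTc
    have h2 : Continuous fun p : ℝ × ℝ => T α p.2 :=
      hTc.comp (continuous_const.prodMk continuous_snd)
    change Continuous fun p : ℝ × ℝ => v p.1 p.2
    simp only [hv]
    fun_prop
  · intro x _
    simp only [hv, sub_self]
    have := mul_nonneg hA0 (sq_nonneg (x - x₀))
    simp
    linarith
  · exact fun t ht => hlat t ht _ (by ring)
  · exact fun t ht => hlat t ht _ (by ring)
  · intro t ht x hx _ hmax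
    obtain ⟨d₁, hd₁, hd₁', -⟩ := exists_deriv_tentIntegral (h.continuous_space t) (hM t) hε.le
    obtain ⟨d₂, hd₂, hd₂', -⟩ := exists_deriv_tentIntegral (h.continuous_space α) (hM α) hε.le
    have hxI : Icc (x - ε) (x + ε) ⊆ I :=
      (Icc_subset_Icc (by linarith [hx.1]) (by linarith [hx.2])).trans hI
    have hsd : ∀ t, Continuous fun y => secondDiff ε (u t) y := fun t => by
      have := h.continuous_space t
      unfold secondDiff
      fun_prop
    have hD : e * (secondDiff ε (u t) x - secondDiff ε (u α) x) / ε ^ 2 - 2 * A ≤ 0 := by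
      refine second_deriv_nonpos_of_isLocalMax (g := v t)
        (g' := fun y => e * (d₁ y - d₂ y) / ε ^ 2 - 2 * A * (y - x₀))
        (g'' := fun y => e * (secondDiff ε (u t) y - secondDiff ε (u α) y) / ε ^ 2 - 2 * A)
        (fun y => ?_) (fun y => ?_) ?_ hmax
      · have h1 := ((((hd₁ y).sub (hd₂ y)).const_mul e).div_const (ε ^ 2)).sub_const (L * (t - α))
        have h2 := (((hasDerivAt_id y).sub_const x₀).pow 2).const_mul A
        refine (h1.sub h2).congr_deriv ?_
        simp
        ring
      · have h1 := (((hd₁' y).sub (hd₂' y)).const_mul e).div_const (ε ^ 2)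
        have h2 := ((hasDerivAt_id y).sub_const x₀).const_mul (2 * A)
        refine (h1.sub h2).congr_deriv ?_
        simp
      · have h1 := hsd t
        have h2 := hsd α
        fun_prop
    refine ⟨e * weakRate V u ε x t / ε ^ 2 - L, ?_, ?_⟩
    · have h1 : e * secondDiff ε (u α) x ≤ n * ε ^ 2 := by
        refine (le_abs_self _).trans ?_
        rw [abs_mul, he, one_mul]
        exact hα x ε hε hxI
      have h2 : -(Λ * M * ε ^ 2) ≤ e * tentIntegral ε (fun x => V x * u t x) x := by
        refine neg_le_of_abs_le ?_
        rw [abs_mul, he, one_mul]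
        refine abs_tentIntegral_le (hV.mul (h.continuous_space t)) hε.le fun y _ => ?_
        change |V y * u t y| ≤ _
        rw [abs_mul]
        exact mul_le_mul (hΛ y) (hM t y) (abs_nonneg _) hΛ0
      have h3 : e * (secondDiff ε (u t) x - secondDiff ε (u α) x) ≤ 2 * A * ε ^ 2 := by
        rw [← div_le_iff₀ hε2]
        linarith
      have h4 : e * weakRate V u ε x t / ε ^ 2 ≤ n + 2 * A + Λ * M := by
        rw [div_le_iff₀ hε2, weakRate]
        linarith
      linarith
    · have h1 := (((hweak t ht x ε hε hxI).sub_const (T α x)).const_mul e).div_const (ε ^ 2)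
      have h2 := ((hasDerivAt_id t).sub_const α).const_mul L
      refine ((h1.sub h2).sub_const (A * (x - x₀) ^ 2)).congr_deriv ?_
      simp

/-- A weak solution moves at bounded speed away from data with bounded second differences. -/
theorem abs_sub_le_of_hasWeakRate {V : ℝ → ℝ} {u ux uxx : ℝ → ℝ → ℝ}
    (h : IsPointwiseSolution V u ux uxx) (hV : Continuous V) {Λ M : ℝ} (hΛ : ∀ x, |V x| ≤ Λ)
    (hM : ∀ t x, |u t x| ≤ M) {I : Set ℝ} {α s n ρ x₀ : ℝ} (hαs : α ≤ s) (hρ : 0 < ρ)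
    (hI : Icc (x₀ - 2 * ρ) (x₀ + 2 * ρ) ⊆ I)
    (hweak : ∀ t ∈ Ioc α s, HasWeakRate V u I t) (hα : SecondDiffBound I n (u α)) :
    |u s x₀ - u α x₀| ≤ (n + 4 * M / ρ ^ 2 + Λ * M + 1) * (s - α) := by
  have key : ∀ e : ℝ, |e| = 1 →
      e * (u s x₀ - u α x₀) ≤ (n + 4 * M / ρ ^ 2 + Λ * M + 1) * (s - α) := by
    intro e he
    refine le_of_tendsto (((tendsto_tentIntegral_div (h.continuous_space s) x₀).sub
      (tendsto_tentIntegral_div (h.continuous_space α) x₀)).const_mul e) ?_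
    filter_upwards [Ioc_mem_nhdsGT hρ] with ε hε
    have := tentIntegral_sub_le_of_hasWeakRate h hV hΛ hM hαs hρ he hε.1 hε.2 hI hweak hα
    rwa [← sub_div, ← mul_div_assoc]
  rw [abs_le]
  constructor
  · linarith [key (-1) (by simp)]
  · linarith [key 1 (by simp)]

theorem abs_sub_le_of_forall_gap {k : ℝ → ℝ} (hk : Continuous k) {P : Set ℝ} (hP : IsClosed P)
    {L t s : ℝ} (ht : t ∈ P) (hts : t ≤ s)
    (hder : ∀ σ ∈ P, t ≤ σ → σ < s → ∀ᶠ r in nhdsWithin σ (Ioi σ), |k r - k σ| ≤ L * (r - σ))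
    (hgap : ∀ σ ∈ P, ∀ r, t ≤ σ → σ ≤ r → r ≤ s → (∀ τ ∈ Ioc σ r, τ ∉ P) →
      |k r - k σ| ≤ L * (r - σ)) :
    |k s - k t| ≤ L * (s - t) := by
  have htrans : ∀ {σ r}, |k σ - k t| ≤ L * (σ - t) → |k r - k σ| ≤ L * (r - σ) →
      |k r - k t| ≤ L * (r - t) := fun {σ r} h1 h2 => by
    have := abs_sub_le (k r) (k σ) (k t)
    linarith
  set A : Set ℝ := {r | |k r - k t| ≤ L * (r - t)} ∩ (P ∩ Icc t s) with hA
  have hAc : IsCompact A := by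
    refine IsCompact.inter_left (isCompact_Icc.inter_left hP) (isClosed_le ?_ ?_) <;> fun_prop
  obtain ⟨σ, ⟨hσ1, hσP, hσ⟩, hmax⟩ := hAc.exists_isGreatest ⟨t, by simp, ht, le_rfl, hts⟩
  have hout : ∀ r, σ < r → r ≤ s → r ∈ P → |k r - k σ| ≤ L * (r - σ) → False :=
    fun r h1 h2 h3 h4 => h1.not_ge (hmax ⟨htrans hσ1 h4, h3, hσ.1.trans h1.le, h2⟩)
  by_cases hfree : ∀ τ ∈ Ioc σ s, τ ∉ P
  · exact htrans hσ1 (hgap σ hσP s hσ.1 hσ.2 le_rfl hfree)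
  push Not at hfree
  obtain ⟨τ, hτ, hτP⟩ := hfree
  exfalso
  obtain ⟨δ, hδ, hδ'⟩ := mem_nhdsGT_iff_exists_Ioo_subset.1
    (hder σ hσP hσ.1 (hτ.1.trans_le hτ.2))
  have hδσ : σ < δ := hδ
  have hnear : ∀ r ∈ Ioo σ δ, r ≤ s → r ∉ P := fun r hr hrs hrP => hout r hr.1 hrs hrP (hδ' hr)
  have hτδ : δ ≤ τ := not_lt.1 fun h => hnear τ ⟨hτ.1, h⟩ hτ.2 hτP
  obtain ⟨β, ⟨hβP, hβ⟩, hmin⟩ := ((isCompact_Icc (a := δ) (b := s)).inter_left hP).exists_isLeast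
    ⟨τ, hτP, hτδ, hτ.2⟩
  have hσβ : σ < β := hδσ.trans_le hβ.1
  refine hout β hσβ hβ.2 hβP ?_
  have hlim1 : Tendsto (fun r => |k r - k σ|) (nhdsWithin β (Iio β)) (nhds |k β - k σ|) :=
    (Continuous.tendsto (by fun_prop) β).mono_left nhdsWithin_le_nhds
  have hlim2 : Tendsto (fun r => L * (r - σ)) (nhdsWithin β (Iio β)) (nhds (L * (β - σ))) :=
    (Continuous.tendsto (by fun_prop) β).mono_left nhdsWithin_le_nhds
  refine le_of_tendsto_of_tendsto hlim1 hlim2 ?_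
  filter_upwards [Ioo_mem_nhdsLT hσβ] with r hr
  have hrs : r ≤ s := hr.2.le.trans hβ.2
  refine hgap σ hσP r hσ.1 hr.1.le hrs fun x hx hxP => ?_
  rcases lt_or_ge x δ with h | h
  · exact hnear x ⟨hx.1, h⟩ (hx.2.trans hrs) hxP
  · exact (hx.2.trans_lt hr.2).not_ge (hmin ⟨hxP, h, hx.2.trans hrs⟩)

/-- A continuous function with a continuous right derivative is differentiable. -/
theorem hasDerivAt_of_continuous_right_deriv {g w : ℝ → ℝ} {a b t : ℝ} (hg : Continuous g)
    (hw : Continuous w) (ht : t ∈ Ioo a b)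
    (hgw : ∀ s ∈ Ioo a b, HasDerivWithinAt g (w s) (Ici s) s) : HasDerivAt g (w t) t := by
  obtain ⟨a', ha, hat⟩ := exists_between ht.1
  obtain ⟨b', htb, hb⟩ := exists_between ht.2
  have hW : ∀ s, HasDerivAt (fun s => ∫ x in a'..s, w x) (w s) s := fun s =>
    intervalIntegral.integral_hasDerivAt_right (hw.intervalIntegrable _ _)
      (hw.stronglyMeasurableAtFilter _ _) hw.continuousAt
  have hWc : Continuous fun s => ∫ x in a'..s, w x :=
    continuous_iff_continuousAt.2 fun s => (hW s).continuousAt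
  have key : ∀ s ∈ Icc a' b', g s - ∫ x in a'..s, w x = g a' - ∫ x in a'..a', w x :=
    constant_of_has_deriv_right_zero (hg.sub hWc).continuousOn fun s hs => by
      refine ((hgw s ⟨ha.trans_le hs.1, hs.2.trans hb⟩).sub
        (hW s).hasDerivWithinAt).congr_deriv (sub_self _)
  refine ((hW t).add_const (g a' - ∫ x in a'..a', w x)).congr_of_eventuallyEq ?_
  filter_upwards [Ioo_mem_nhds hat htb] with s hs
  linarith [key s ⟨hs.1.le, hs.2.le⟩]

theorem IsPointwiseSolution.weakRate_eq {V : ℝ → ℝ} {u ux uxx : ℝ → ℝ → ℝ}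
    (h : IsPointwiseSolution V u ux uxx) (hV : Continuous V) (r c t : ℝ) :
    weakRate V u r c t = tentIntegral r (fun x => uxx t x - V x * u t x) c := by
  rw [weakRate, tentIntegral_sub (h.continuous_uxx t)
    (h := fun x => V x * u t x) (hV.mul (h.continuous_space t)),
    tentIntegral_deriv_deriv (h.hasDerivAt_space t) (h.hasDerivAt_space' t) (h.continuous_uxx t)]

theorem IsPointwiseSolution.hasDerivWithinAt_tentIntegral {V : ℝ → ℝ} {u ux uxx : ℝ → ℝ → ℝ}
    (h : IsPointwiseSolution V u ux uxx) (hV : Continuous V) {t L r c : ℝ} (ht : t < 0)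
    (hr : 0 < r) (hL : ∀ᶠ s in nhdsWithin t (Ioi t), ∀ x ∈ Icc (c - r) (c + r),
      |u s x - u t x| ≤ L * (s - t)) :
    HasDerivWithinAt (fun s => tentIntegral r (u s) c) (weakRate V u r c t) (Ici t) t := by
  rw [← hasDerivWithinAt_Ioi_iff_Ici, hasDerivWithinAt_iff_tendsto_slope' self_notMem_Ioi,
    h.weakRate_eq hV]
  have e : ∀ s, slope (fun s => tentIntegral r (u s) c) t s
      = tentIntegral r (fun x => (s - t)⁻¹ * (u s x - u t x)) c := fun s => by
    rw [tentIntegral_const_mul, tentIntegral_sub (h.continuous_space s) (h.continuous_space t)]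
    rfl
  simp only [funext e]
  refine intervalIntegral.tendsto_integral_filter_of_dominated_convergence
    (fun y => |r - y| * (2 * L)) ?_ ?_ ?_ ?_
  · refine Eventually.of_forall fun s => ?_
    have h1 := h.continuous_space s
    have h2 := h.continuous_space t
    exact Continuous.aestronglyMeasurable (by fun_prop)
  · filter_upwards [hL, self_mem_nhdsWithin] with s hs hst
    have hst' : 0 < s - t := sub_pos.2 hst
    have hb : ∀ x ∈ Icc (c - r) (c + r), |(s - t)⁻¹ * (u s x - u t x)| ≤ L := fun x hx => by
      rw [abs_mul, abs_of_pos (inv_pos.2 hst'), inv_mul_le_iff₀ hst', mul_comm]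
      exact hs x hx
    refine Eventually.of_forall fun y hy => ?_
    rw [uIoc_of_le hr.le] at hy
    rw [Real.norm_eq_abs, abs_mul]
    refine mul_le_mul_of_nonneg_left ((abs_add_le _ _).trans ?_) (abs_nonneg _)
    linarith [hb (c + y) ⟨by linarith [hy.1], by linarith [hy.2]⟩,
      hb (c - y) ⟨by linarith [hy.2], by linarith [hy.1]⟩]
  · exact Continuous.intervalIntegrable (by fun_prop) _ _
  · refine Eventually.of_forall fun y _ => ?_
    have hx : ∀ x, Tendsto (fun s => (s - t)⁻¹ * (u s x - u t x)) (nhdsWithin t (Ioi t))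
        (nhds (uxx t x - V x * u t x)) := fun x =>
      (hasDerivWithinAt_iff_tendsto_slope' self_notMem_Ioi).1
        (h.hasDerivAt_time t ht x).hasDerivWithinAt
    exact ((hx (c + y)).add (hx (c - y))).const_mul _

theorem IsPointwiseSolution.abs_uxx_le {V : ℝ → ℝ} {u ux uxx : ℝ → ℝ → ℝ}
    (h : IsPointwiseSolution V u ux uxx) {I : Set ℝ} (hI : IsOpen I) {n t x : ℝ}
    (hn : SecondDiffBound I n (u t)) (hx : x ∈ I) : |uxx t x| ≤ n := by
  refine le_of_tendsto (tendsto_secondDiff_div (h.hasDerivAt_space t) (h.hasDerivAt_space' t)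
    (h.continuous_uxx t) x).abs ?_
  obtain ⟨ε, hε, hb⟩ := Metric.isOpen_iff.1 hI x hx
  filter_upwards [Ioo_mem_nhdsGT hε] with r hr
  have hr2 : 0 < r ^ 2 := pow_pos hr.1 2
  rw [abs_div, abs_of_pos hr2, div_le_iff₀ hr2]
  refine hn x r hr.1 fun y hy => hb ?_
  rw [Metric.mem_ball, Real.dist_eq]
  exact (abs_le.2 ⟨by linarith [hy.1], by linarith [hy.2]⟩).trans_lt hr.2

theorem IsPointwiseSolution.exists_secondDiffBound {V : ℝ → ℝ} {u ux uxx : ℝ → ℝ → ℝ}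
    (h : IsPointwiseSolution V u ux uxx) (N t : ℝ) :
    ∃ n : ℕ, SecondDiffBound (Ioo (-N) N) n (u t) := by
  obtain ⟨K, hK⟩ := (isCompact_Icc (a := -N) (b := N)).exists_bound_of_continuousOn
    (h.continuous_uxx t).continuousOn
  obtain ⟨n, hn⟩ := exists_nat_ge K
  refine ⟨n, fun c r hr hc => ?_⟩
  rw [← tentIntegral_deriv_deriv (h.hasDerivAt_space t) (h.hasDerivAt_space' t)
    (h.continuous_uxx t)]
  exact abs_tentIntegral_le (h.continuous_uxx t) hr.le fun x hx =>
    (hK x (Ioo_subset_Icc_self (hc hx))).trans hn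

theorem isClosed_setOf_secondDiffBound {u : ℝ → ℝ → ℝ} (hu : ∀ x, Continuous fun t => u t x)
    (I : Set ℝ) (n : ℝ) : IsClosed {t | SecondDiffBound I n (u t)} := by
  simp only [SecondDiffBound, ofPred_forall]
  refine isClosed_iInter fun c => isClosed_iInter fun r => isClosed_iInter fun _ =>
    isClosed_iInter fun _ => isClosed_le ?_ continuous_const
  have h1 := hu (c + r)
  have h2 := hu c
  have h3 := hu (c - r)
  simp only [secondDiff]
  fun_prop

/-- Near times at which the weak form may fail the second differences cannot be uniformly
bounded. -/
theorem hasWeakRate_of_secondDiffBound {V : ℝ → ℝ} {u ux uxx : ℝ → ℝ → ℝ}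
    (h : IsPointwiseSolution V u ux uxx) (hV : Continuous V) {Λ M : ℝ} (hΛ : ∀ x, |V x| ≤ Λ)
    (hM : ∀ t x, |u t x| ≤ M) {N a b n : ℝ} (hb : b ≤ 0)
    (hn : ∀ t ∈ Ioo a b, t ∉ interior {t | HasWeakRate V u (Ioo (-N) N) t} →
      SecondDiffBound (Ioo (-N) N) n (u t)) :
    ∀ t ∈ Ioo a b, HasWeakRate V u (Ioo (-N) N) t := by
  set I := Ioo (-N) N with hI
  set P : Set ℝ := (interior {t | HasWeakRate V u I t})ᶜ with hPdef
  have hP : IsClosed P := isOpen_interior.isClosed_compl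
  have hnP : ∀ t, t ∉ P → HasWeakRate V u I t := fun t ht => interior_subset (not_not.1 ht)
  intro t ht c r hr hc
  refine hasDerivAt_of_continuous_right_deriv
    (continuous_tentIntegral_param h.continuous_space h.continuous_time hM r c)
    (continuous_weakRate h hV hΛ hM r c) ht fun τ hτ => ?_
  by_cases hτP : τ ∉ P
  · exact (hnP τ hτP c r hr hc).hasDerivWithinAt
  replace hτP := not_not.1 hτP
  have hc1 := (hc (left_mem_Icc.2 (by linarith : c - r ≤ c + r))).1
  have hc2 := (hc (right_mem_Icc.2 (by linarith : c - r ≤ c + r))).2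
  obtain ⟨ρ, hρ, hρ'⟩ : ∃ ρ > 0, ρ < min (c - r + N) (N - (c + r)) :=
    exists_between (lt_min (by linarith) (by linarith))
  have hρ1 := hρ'.trans_le (min_le_left _ _)
  have hρ2 := hρ'.trans_le (min_le_right _ _)
  set L : ℝ := n + 4 * M / (ρ / 2) ^ 2 + Λ * M + 1 with hLdef
  refine h.hasDerivWithinAt_tentIntegral hV (L := L) (hτ.2.trans_le hb) hr ?_
  filter_upwards [Ioo_mem_nhdsGT hτ.2] with s hs x hx
  have hxI : Icc (x - 2 * (ρ / 2)) (x + 2 * (ρ / 2)) ⊆ I := fun y hy =>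
    ⟨by linarith [hy.1, hx.1], by linarith [hy.2, hx.2]⟩
  refine abs_sub_le_of_forall_gap (h.continuous_time x) hP hτP hs.1.le ?_ ?_
  · intro σ hσP hσ1 hσ2
    have hσ : σ ∈ Ioo a b := ⟨hτ.1.trans_le hσ1, hσ2.trans hs.2⟩
    have hder := h.hasDerivAt_time σ (hσ.2.trans_le hb) x
    have hlt : |uxx σ x - V x * u σ x| < L := by
      have h1 := h.abs_uxx_le isOpen_Ioo (hn σ hσ hσP) (@hxI x ⟨by linarith, by linarith⟩)
      have h2 : |V x * u σ x| ≤ Λ * M := by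
        rw [abs_mul]
        exact mul_le_mul (hΛ x) (hM σ x) (abs_nonneg _) ((abs_nonneg _).trans (hΛ x))
      have h3 : 0 ≤ 4 * M / (ρ / 2) ^ 2 := by
        have := (abs_nonneg _).trans (hM 0 0)
        positivity
      have := abs_sub (uxx σ x) (V x * u σ x)
      linarith
    have hsl := ((hasDerivAt_iff_tendsto_slope_left_right.1 hder).2.abs).eventually
      (gt_mem_nhds hlt)
    filter_upwards [hsl, self_mem_nhdsWithin] with q hq hq'
    have hq0 : 0 < q - σ := sub_pos.2 hq'
    rw [slope_def_field, abs_div, abs_of_pos hq0, div_lt_iff₀ hq0] at hq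
    exact hq.le
  · intro σ hσP q hσ1 hσ2 hσ3 hfree
    exact abs_sub_le_of_hasWeakRate h hV hΛ hM hσ2 (by positivity) hxI
      (fun t ht => hnP t (hfree t ht))
      (hn σ ⟨hτ.1.trans_le hσ1, (hσ2.trans hσ3).trans_lt hs.2⟩ hσP)

/-- A bounded pointwise solution is a weak solution. -/
theorem IsPointwiseSolution.hasWeakRate {V : ℝ → ℝ} {u ux uxx : ℝ → ℝ → ℝ}
    (h : IsPointwiseSolution V u ux uxx) (hV : Continuous V) {Λ M : ℝ} (hΛ : ∀ x, |V x| ≤ Λ)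
    (hM : ∀ t x, |u t x| ≤ M) (N : ℝ) {t : ℝ} (ht : t < 0) :
    HasWeakRate V u (Ioo (-N) N) t := by
  set I := Ioo (-N) N with hI
  set O : Set ℝ := interior {t | HasWeakRate V u I t} with hO
  by_contra hcon
  have htO : t ∉ O := fun h' => hcon (interior_subset h')
  have hlc : IsLocallyClosed (Oᶜ ∩ Iio 0) :=
    isOpen_interior.isClosed_compl.isLocallyClosed.inter isOpen_Iio.isLocallyClosed
  have : LocallyCompactSpace ↥(Oᶜ ∩ Iio 0) := hlc.locallyCompactSpace
  have : Nonempty ↥(Oᶜ ∩ Iio 0) := ⟨⟨t, htO, ht⟩⟩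
  obtain ⟨n, x, hx⟩ := nonempty_interior_of_iUnion_of_closed
    (f := fun n : ℕ => {x : ↥(Oᶜ ∩ Iio 0) | SecondDiffBound I n (u x)})
    (fun n => (isClosed_setOf_secondDiffBound h.continuous_time I n).preimage
      continuous_subtype_val)
    (eq_univ_of_forall fun x => mem_iUnion.2 (h.exists_secondDiffBound N x))
  obtain ⟨W, hW, hWx⟩ := mem_nhds_subtype _ _ _ |>.1 (mem_interior_iff_mem_nhds.1 hx)
  obtain ⟨a, b, hxab, hab⟩ := mem_nhds_iff_exists_Ioo_subset.1
    (inter_mem hW (Iio_mem_nhds x.2.2))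
  have hb : b ≤ 0 := by
    by_contra! hb
    have hx0 : x.1 < 0 := x.2.2
    exact lt_irrefl (0 : ℝ) (hab ⟨hxab.1.trans hx0, hb⟩).2
  have key := hasWeakRate_of_secondDiffBound h hV hΛ hM (N := N) (a := a) (b := b) (n := n) hb
    fun τ hτ hτO => @hWx ⟨τ, hτO, (hab hτ).2⟩ (hab hτ).1
  exact x.2.1 (interior_maximal key isOpen_Ioo hxab)

/-- The average of `u` over the unit time interval ending at `t`. -/
noncomputable def timeAvg (u : ℝ → ℝ → ℝ) (t x : ℝ) : ℝ := ∫ s in (t - 1)..t, u s x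

theorem hasDerivAt_timeAvg {u : ℝ → ℝ → ℝ} {x : ℝ} (hu : Continuous fun t => u t x) (t : ℝ) :
    HasDerivAt (fun s => timeAvg u s x) (u t x - u (t - 1) x) t := by
  have h1 : ∀ s, HasDerivAt (fun s => ∫ τ in (0 : ℝ)..s, u τ x) (u s x) s := fun s =>
    intervalIntegral.integral_hasDerivAt_right (hu.intervalIntegrable _ _)
      (hu.stronglyMeasurableAtFilter _ _) hu.continuousAt
  refine ((h1 t).sub ((h1 (t - 1)).comp_sub_const t 1)).congr_of_eventuallyEq
    (Eventually.of_forall fun s => ?_)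
  exact (intervalIntegral.integral_interval_sub_left (hu.intervalIntegrable _ _)
    (hu.intervalIntegrable _ _)).symm

theorem continuous_timeAvg_time {u : ℝ → ℝ → ℝ} {x : ℝ} (hu : Continuous fun t => u t x) :
    Continuous fun t => timeAvg u t x :=
  continuous_iff_continuousAt.2 fun t => (hasDerivAt_timeAvg hu t).continuousAt

theorem continuous_timeAvg_space {u : ℝ → ℝ → ℝ} (hx : ∀ t, Continuous (u t))
    (ht : ∀ x, Continuous fun t => u t x) {M : ℝ} (hM : ∀ t x, |u t x| ≤ M) (t : ℝ) :
    Continuous (timeAvg u t) :=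
  intervalIntegral.continuous_of_dominated_interval (bound := fun _ => M)
    (fun x => (ht x).aestronglyMeasurable)
    (fun x => Eventually.of_forall fun s _ => hM s x) (by simp)
    (Eventually.of_forall fun s _ => hx s)

theorem continuous_uncurry_timeAvg {u : ℝ → ℝ → ℝ} (hx : ∀ t, Continuous (u t))
    (ht : ∀ x, Continuous fun t => u t x) {M : ℝ} (hM : ∀ t x, |u t x| ≤ M) :
    Continuous (Function.uncurry (timeAvg u)) := by
  have hM0 : 0 ≤ M := (abs_nonneg _).trans (hM 0 0)
  refine continuous_prod_of_continuous_lipschitzWith _ (Real.toNNReal (2 * M))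
    (fun t => continuous_timeAvg_space hx ht hM t) fun x => ?_
  refine LipschitzWith.of_dist_le_mul fun s t => ?_
  rw [Real.coe_toNNReal _ (by positivity), Real.dist_eq, Real.dist_eq]
  have := Convex.norm_image_sub_le_of_norm_hasDerivWithin_le (s := univ) (C := 2 * M) (x := t)
    (y := s) (fun t _ => (hasDerivAt_timeAvg (ht x) t).hasDerivWithinAt)
    (fun t _ => (abs_sub (u t x) (u (t - 1) x)).trans (by linarith [hM t x, hM (t - 1) x]))
    convex_univ (mem_univ _) (mem_univ _)
  simpa using this

theorem abs_timeAvg_le {u : ℝ → ℝ → ℝ} {x K t : ℝ} (hK : ∀ s ≤ t, |u s x| ≤ K) :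
    |timeAvg u t x| ≤ K := by
  have := intervalIntegral.norm_integral_le_of_norm_le_const (f := fun s => u s x) (a := t - 1)
    (b := t) (C := K) fun s hs => hK s (by rw [uIoc_of_le (by linarith)] at hs; exact hs.2)
  simpa [timeAvg] using this

theorem exp_mul_min_mono {a : ℝ} (ha : 0 ≤ a) {s t : ℝ} (h : s ≤ t) :
    Real.exp (a * min s 0) ≤ Real.exp (a * min t 0) :=
  Real.exp_le_exp.2 (mul_le_mul_of_nonneg_left (min_le_min_right 0 h) ha)

theorem exp_mul_min_le_one {a : ℝ} (ha : 0 ≤ a) (t : ℝ) : Real.exp (a * min t 0) ≤ 1 :=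
  Real.exp_le_one_iff.2 (mul_nonpos_of_nonneg_of_nonpos ha (min_le_right _ _))

theorem abs_timeAvg_le_exp {u : ℝ → ℝ → ℝ} {a K x : ℝ} (ha : 0 ≤ a)
    (hK : ∀ t, |u t x| ≤ K * Real.exp (a * min t 0)) (t : ℝ) :
    |timeAvg u t x| ≤ K * Real.exp (a * min t 0) := by
  have hK0 : 0 ≤ K :=
    nonneg_of_mul_nonneg_left ((abs_nonneg _).trans (hK 0)) (Real.exp_pos _)
  exact abs_timeAvg_le fun s hs =>
    (hK s).trans (mul_le_mul_of_nonneg_left (exp_mul_min_mono ha hs) hK0)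

theorem tentIntegral_timeAvg {w : ℝ → ℝ → ℝ} (hx : ∀ t, Continuous (w t))
    (ht : ∀ x, Continuous fun t => w t x) {M : ℝ} (hM : ∀ t x, |w t x| ≤ M) {r : ℝ} (hr : 0 ≤ r)
    (c t : ℝ) :
    tentIntegral r (timeAvg w t) c = ∫ s in (t - 1)..t, tentIntegral r (w s) c := by
  have e : ∀ y, (r - y) * (timeAvg w t (c + y) + timeAvg w t (c - y))
      = ∫ s in (t - 1)..t, (r - y) * (w s (c + y) + w s (c - y)) := fun y => by
    rw [intervalIntegral.integral_const_mul, intervalIntegral.integral_add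
      ((ht _).intervalIntegrable _ _) ((ht _).intervalIntegrable _ _)]
    rfl
  simp only [tentIntegral, e]
  rw [intervalIntegral.integral_of_le hr]
  simp only [intervalIntegral.integral_of_le (show t - 1 ≤ t by linarith),
    intervalIntegral.integral_of_le hr]
  refine MeasureTheory.integral_integral_swap ?_
  rw [MeasureTheory.Measure.prod_restrict]
  have hmeas : Measurable (Function.uncurry fun y s => (r - y) * (w s (c + y) + w s (c - y))) := by
    refine MeasureTheory.measurable_uncurry_of_continuous_of_measurable (fun s => ?_) fun y => ?_
    · have := hx s
      fun_prop
    · have h1 := ht (c + y)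
      have h2 := ht (c - y)
      exact Continuous.measurable (by fun_prop)
  have hb : MeasureTheory.IntegrableOn (fun p : ℝ × ℝ => |r - p.1| * (2 * M))
      (Ioc 0 r ×ˢ Ioc (t - 1) t) (MeasureTheory.volume.prod MeasureTheory.volume) :=
    (ContinuousOn.integrableOn_compact (isCompact_Icc.prod isCompact_Icc)
      (Continuous.continuousOn (by fun_prop))).mono_set
      (prod_mono Ioc_subset_Icc_self Ioc_subset_Icc_self)
  refine MeasureTheory.Integrable.mono' hb hmeas.aestronglyMeasurable
    (Eventually.of_forall fun p => ?_)
  rw [Function.uncurry_def, Real.norm_eq_abs, abs_mul]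
  refine mul_le_mul_of_nonneg_left ((abs_add_le _ _).trans ?_) (abs_nonneg _)
  linarith [hM p.2 (c + p.1), hM p.2 (c - p.1)]

theorem IsPointwiseSolution.exists_deriv_timeAvg {V : ℝ → ℝ} {u ux uxx : ℝ → ℝ → ℝ}
    (h : IsPointwiseSolution V u ux uxx) (hV : Continuous V) {Λ M : ℝ} (hΛ : ∀ x, |V x| ≤ Λ)
    (hM : ∀ t x, |u t x| ≤ M) {t : ℝ} (ht : t ≤ 0) :
    ∃ g' : ℝ → ℝ, (∀ x, HasDerivAt (timeAvg u t) (g' x) x) ∧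
      ∀ x, HasDerivAt g' (V x * timeAvg u t x + (u t x - u (t - 1) x)) x := by
  have hAc := continuous_timeAvg_space h.continuous_space h.continuous_time hM t
  have hVA : Continuous fun x => V x * timeAvg u t x := hV.mul hAc
  have hdu : Continuous fun x => u t x - u (t - 1) x :=
    (h.continuous_space t).sub (h.continuous_space (t - 1))
  refine exists_deriv_of_secondDiff hAc (hVA.add hdu) fun c r hr => ?_
  have e1 : tentIntegral r (fun x => V x * timeAvg u t x) c
      = ∫ s in (t - 1)..t, tentIntegral r (fun x => V x * u s x) c := by
    rw [← tentIntegral_timeAvg (w := fun s x => V x * u s x)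
      (fun s => hV.mul (h.continuous_space s))
      (fun x => continuous_const.mul (h.continuous_time x)) (M := Λ * M) (fun s x => ?_) hr.le c t]
    · congr 1
      ext x
      exact (intervalIntegral.integral_const_mul _ _).symm
    · rw [abs_mul]
      exact mul_le_mul (hΛ x) (hM s x) (abs_nonneg _) ((abs_nonneg _).trans (hΛ x))
  have hwc := continuous_weakRate h hV hΛ hM r c
  have e2 : ∫ s in (t - 1)..t, weakRate V u r c s
      = tentIntegral r (u t) c - tentIntegral r (u (t - 1)) c := by
    refine intervalIntegral.integral_eq_sub_of_hasDerivAt_of_le (by linarith)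
      (continuous_tentIntegral_param h.continuous_space h.continuous_time hM r c).continuousOn
      (fun s hs => ?_) (hwc.intervalIntegrable _ _)
    refine h.hasWeakRate hV hΛ hM (|c| + r + 1) (hs.2.trans_le ht) c r hr fun x hx => ?_
    have h1 := neg_abs_le c
    have h2 := le_abs_self c
    exact ⟨by linarith [hx.1], by linarith [hx.2]⟩
  have hi : ∀ x, IntervalIntegrable (fun s => u s x) MeasureTheory.volume (t - 1) t := fun x =>
    (h.continuous_time x).intervalIntegrable _ _
  have hsd : Continuous fun s => secondDiff r (u s) c :=
    ((h.continuous_time (c + r)).sub (continuous_const.mul (h.continuous_time c))).add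
      (h.continuous_time (c - r))
  have hVt : Continuous fun s => tentIntegral r (fun x => V x * u s x) c := by
    refine (hsd.sub hwc).congr fun s => ?_
    simp [weakRate]
  have e3 : ∫ s in (t - 1)..t, weakRate V u r c s
      = secondDiff r (timeAvg u t) c - tentIntegral r (fun x => V x * timeAvg u t x) c := by
    rw [e1]
    simp only [weakRate]
    rw [intervalIntegral.integral_sub (hsd.intervalIntegrable _ _) (hVt.intervalIntegrable _ _)]
    congr 1
    simp only [secondDiff, timeAvg]
    rw [intervalIntegral.integral_add ((hi _).sub ((hi _).const_mul 2)) (hi _),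
      intervalIntegral.integral_sub (hi _) ((hi _).const_mul 2),
      intervalIntegral.integral_const_mul]
  have e4 := tentIntegral_sub
    (g := fun x => V x * timeAvg u t x + (u t x - u (t - 1) x)) (hVA.add hdu) hdu r c
  have e5 := tentIntegral_sub (h.continuous_space t) (h.continuous_space (t - 1)) r c
  have e6 : tentIntegral r (fun x => (V x * timeAvg u t x + (u t x - u (t - 1) x))
      - (u t x - u (t - 1) x)) c = tentIntegral r (fun x => V x * timeAvg u t x) c := by
    simp
  linarith

/-- The time average of `u`, frozen at its value at time `0` for positive times. -/
noncomputable def clampAvg (u : ℝ → ℝ → ℝ) (t x : ℝ) : ℝ := timeAvg u (min t 0) x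

theorem clampAvg_of_nonpos {u : ℝ → ℝ → ℝ} {t : ℝ} (ht : t ≤ 0) : clampAvg u t = timeAvg u t := by
  ext x
  rw [clampAvg, min_eq_left ht]

theorem abs_clampAvg_le {u : ℝ → ℝ → ℝ} {a K x : ℝ} (ha : 0 ≤ a)
    (hK : ∀ t, |u t x| ≤ K * Real.exp (a * min t 0)) (t : ℝ) :
    |clampAvg u t x| ≤ K * Real.exp (a * min t 0) := by
  have := abs_timeAvg_le_exp ha hK (min t 0)
  rwa [min_eq_left (min_le_right t 0)] at this

theorem continuous_uncurry_clampAvg {u : ℝ → ℝ → ℝ} (hx : ∀ t, Continuous (u t))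
    (ht : ∀ x, Continuous fun t => u t x) {M : ℝ} (hM : ∀ t x, |u t x| ≤ M) :
    Continuous (Function.uncurry (clampAvg u)) := by
  have h1 : Continuous fun p : ℝ × ℝ => (min p.1 0, p.2) := by fun_prop
  exact (continuous_uncurry_timeAvg hx ht hM).comp h1

theorem IsPointwiseSolution.exists_clampAvg {V : ℝ → ℝ} {u ux uxx : ℝ → ℝ → ℝ}
    (h : IsPointwiseSolution V u ux uxx) (hV : Continuous V) {Λ M : ℝ} (hΛ : ∀ x, |V x| ≤ Λ)
    (hM : ∀ t x, |u t x| ≤ M) :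
    ∃ wx wxx, IsPointwiseSolution V (clampAvg u) wx wxx := by
  choose g hg hg' using fun t : ℝ => h.exists_deriv_timeAvg hV hΛ hM (min_le_right t 0)
  refine ⟨g, _, fun x => ?_, hg, hg', fun t => ?_, fun t ht x => ?_⟩
  · exact (continuous_timeAvg_time (h.continuous_time x)).comp (by fun_prop)
  · exact (hV.mul (continuous_timeAvg_space h.continuous_space h.continuous_time hM _)).add
      ((h.continuous_space _).sub (h.continuous_space _))
  · rw [min_eq_left ht.le, clampAvg_of_nonpos ht.le, add_sub_cancel_left]
    refine (hasDerivAt_timeAvg (h.continuous_time x) t).congr_of_eventuallyEq ?_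
    filter_upwards [Iio_mem_nhds ht] with s hs
    rw [clampAvg_of_nonpos (le_of_lt hs)]

theorem mul_exp_le_of_barrier {V : ℝ → ℝ} {u ux uxx : ℝ → ℝ → ℝ}
    (h : IsPointwiseSolution V u ux uxx) (hu : Continuous (Function.uncurry u)) {a C R σ κ e : ℝ}
    (ha : 0 < a) (hσ : 0 < σ) (hσa : σ ^ 2 = a / 16) (hκ : 0 < κ) (he : |e| = 1)
    (hV : ∀ x, R ≤ x → |V x| ≤ a / 4) (hC : ∀ t x, |u t x| ≤ C * Real.exp (a * min t 0))
    {t₁ y : ℝ} (ht₁ : t₁ < 0) (hy : R ≤ y) :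
    e * Real.exp (-(a / 2) * t₁) * u t₁ y
      ≤ C * Real.exp (-σ * (y - R)) + κ * Real.exp (σ * (y - R)) := by
  have hC0 : 0 ≤ C := nonneg_of_mul_nonneg_left ((abs_nonneg _).trans (hC 0 0)) (Real.exp_pos _)
  have hbound : ∀ t ≤ 0, ∀ x, e * Real.exp (-(a / 2) * t) * u t x ≤ C * Real.exp (a / 2 * t) := by
    intro t ht x
    refine (le_abs_self _).trans ?_
    rw [abs_mul, abs_mul, he, one_mul, Real.abs_exp]
    refine (mul_le_mul_of_nonneg_left (hC t x) (Real.exp_pos _).le).trans_eq ?_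
    rw [min_eq_left ht, mul_left_comm, ← Real.exp_add]
    ring_nf
  have hone : ∀ t ≤ 0, Real.exp (a / 2 * t) ≤ 1 := fun t ht =>
    Real.exp_le_one_iff.2 (mul_nonpos_of_nonneg_of_nonpos (by positivity) ht)
  obtain ⟨t₀, ht₀, ht₀κ⟩ : ∃ t₀ ≤ t₁, C * Real.exp (a / 2 * t₀) ≤ κ := by
    have hlim : Tendsto (fun t => C * Real.exp (a / 2 * t)) atBot (nhds (C * 0)) :=
      (Real.tendsto_exp_atBot.comp
        (tendsto_id.const_mul_atBot (by positivity : 0 < a / 2))).const_mul C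
    rw [mul_zero] at hlim
    obtain ⟨t₀, h1, h2⟩ := ((hlim.eventually (gt_mem_nhds hκ)).and (eventually_le_atBot t₁)).exists
    exact ⟨t₀, h2, h1.le⟩
  obtain ⟨X, hX, hXκ⟩ : ∃ X ≥ y, C ≤ κ * Real.exp (σ * (X - R)) := by
    have hlim : Tendsto (fun X => κ * Real.exp (σ * (X - R))) atTop atTop :=
      (Real.tendsto_exp_atTop.comp
        ((tendsto_atTop_add_const_right atTop (-R) tendsto_id).const_mul_atTop hσ)).const_mul_atTop
          hκ
    obtain ⟨X, h1, h2⟩ := ((hlim.eventually (eventually_ge_atTop C)).and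
      (eventually_ge_atTop y)).exists
    exact ⟨X, h2, h1⟩
  set S : ℝ → ℝ := fun x => C * Real.exp (-σ * (x - R)) + κ * Real.exp (σ * (x - R)) with hS
  have hS0 : ∀ x, 0 < S x := fun x => by
    have h1 := Real.exp_pos (-σ * (x - R))
    have h2 := Real.exp_pos (σ * (x - R))
    simp only [hS]
    positivity
  have hSκ : ∀ x, κ * Real.exp (σ * (x - R)) ≤ S x := fun x => by
    have := mul_nonneg hC0 (Real.exp_pos (-σ * (x - R))).le
    simp only [hS]
    linarith
  have hSc : Continuous S := by fun_prop
  set v : ℝ → ℝ → ℝ := fun t x => e * Real.exp (-(a / 2) * t) * u t x - S x with hv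
  have hexp : ∀ k x : ℝ, HasDerivAt (fun x => Real.exp (k * (x - R)))
      (k * Real.exp (k * (x - R))) x := fun k x => by
    have := (((hasDerivAt_id x).sub_const R).const_mul k).exp
    refine this.congr_deriv ?_
    simp [mul_comm]
  have main := nonpos_of_parabolic_boundary (v := v) (t₀ := t₀) (t₁ := t₁) (c := R) (d := X)
    ?_ ?_ ?_ ?_ ?_ t₁ ⟨ht₀, le_rfl⟩ y ⟨hy, hX⟩
  · simp only [hv] at main
    linarith
  · have h1 : Continuous fun p : ℝ × ℝ => u p.1 p.2 := hu
    change Continuous fun p : ℝ × ℝ => v p.1 p.2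
    simp only [hv]
    fun_prop
  · intro x hx
    have h1 := hbound t₀ (ht₀.trans ht₁.le) x
    have h2 : κ ≤ κ * Real.exp (σ * (x - R)) :=
      le_mul_of_one_le_right hκ.le (Real.one_le_exp (mul_nonneg hσ.le (sub_nonneg.2 hx.1)))
    simp only [hv]
    linarith [hSκ x]
  · intro t ht
    have h0 : t ≤ 0 := ht.2.trans ht₁.le
    have h1 := (hbound t h0 R).trans (mul_le_of_le_one_right hC0 (hone t h0))
    simp only [hv, hS, sub_self, mul_zero, Real.exp_zero, mul_one]
    linarith
  · intro t ht
    have h0 : t ≤ 0 := ht.2.trans ht₁.le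
    have h1 := (hbound t h0 X).trans (mul_le_of_le_one_right hC0 (hone t h0))
    simp only [hv]
    linarith [hSκ X]
  · intro t ht x hx hpos hmax
    have ht0 : t < 0 := ht.2.trans_lt ht₁
    set p := e * Real.exp (-(a / 2) * t) * u t x with hp
    have hpS : S x < p := by
      simp only [hv] at hpos
      linarith
    have hD : e * Real.exp (-(a / 2) * t) * uxx t x - σ ^ 2 * S x ≤ 0 := by
      refine second_deriv_nonpos_of_isLocalMax (g := v t)
        (g' := fun x => e * Real.exp (-(a / 2) * t) * ux t x - (C * (-σ * Real.exp (-σ * (x - R)))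
          + κ * (σ * Real.exp (σ * (x - R)))))
        (g'' := fun x => e * Real.exp (-(a / 2) * t) * uxx t x - σ ^ 2 * S x)
        (fun x => ?_) (fun x => ?_) ?_ hmax
      · exact ((h.hasDerivAt_space t x).const_mul _).sub
          (((hexp (-σ) x).const_mul C).add ((hexp σ x).const_mul κ))
      · refine (((h.hasDerivAt_space' t x).const_mul _).sub
          ((((hexp (-σ) x).const_mul (-σ)).const_mul C).add
            (((hexp σ x).const_mul σ).const_mul κ))).congr_deriv ?_
        simp only [hS]
        ring
      · have := h.continuous_uxx t
        fun_prop
    refine ⟨e * Real.exp (-(a / 2) * t) * uxx t x - (V x + a / 2) * p, ?_, ?_⟩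
    · have h1 : a / 4 * p ≤ (V x + a / 2) * p :=
        mul_le_mul_of_nonneg_right (by linarith [neg_le_of_abs_le (hV x hx.1.le)])
          ((hS0 x).trans hpS).le
      have h2 : σ ^ 2 * S x < a / 4 * p := by
        rw [hσa]
        have := hS0 x
        nlinarith
      linarith
    · have h1 : HasDerivAt (fun s : ℝ => Real.exp (-(a / 2) * s))
          (-(a / 2) * Real.exp (-(a / 2) * t)) t := by
        refine ((hasDerivAt_id t).const_mul (-(a / 2))).exp.congr_deriv ?_
        simp [mul_comm]
      refine (((h1.const_mul e).mul (h.hasDerivAt_time t ht0 x)).sub_const (S x)).congr_deriv ?_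
      simp only [hp]
      ring

theorem abs_le_exp_of_le {V : ℝ → ℝ} {u ux uxx : ℝ → ℝ → ℝ}
    (h : IsPointwiseSolution V u ux uxx) (hu : Continuous (Function.uncurry u)) {a C R σ : ℝ}
    (ha : 0 < a) (hσ : 0 < σ) (hσa : σ ^ 2 = a / 16)
    (hV : ∀ x, R ≤ x → |V x| ≤ a / 4) (hC : ∀ t x, |u t x| ≤ C * Real.exp (a * min t 0))
    {t y : ℝ} (ht : t ≤ 0) (hy : R ≤ y) :
    |u t y| ≤ C * Real.exp (-σ * (y - R)) * Real.exp (a / 2 * t) := by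
  have key : ∀ e : ℝ, |e| = 1 → ∀ t < 0,
      e * u t y ≤ C * Real.exp (-σ * (y - R)) * Real.exp (a / 2 * t) := by
    intro e he t ht
    have hlim : Tendsto (fun κ : ℝ => C * Real.exp (-σ * (y - R)) + κ * Real.exp (σ * (y - R)))
        (nhdsWithin 0 (Ioi 0)) (nhds (C * Real.exp (-σ * (y - R)) + 0 * Real.exp (σ * (y - R)))) :=
      (Continuous.tendsto (by fun_prop) _).mono_left nhdsWithin_le_nhds
    rw [zero_mul, add_zero] at hlim
    have h1 : e * Real.exp (-(a / 2) * t) * u t y ≤ C * Real.exp (-σ * (y - R)) :=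
      ge_of_tendsto hlim (eventually_mem_nhdsWithin.mono fun κ hκ =>
        mul_exp_le_of_barrier h hu ha hσ hσa hκ he hV hC ht hy)
    have h2 := mul_le_mul_of_nonneg_right h1 (Real.exp_pos (a / 2 * t)).le
    refine le_trans (le_of_eq ?_) h2
    rw [mul_right_comm, mul_assoc e, ← Real.exp_add]
    simp
  have hneg : ∀ t < 0, |u t y| ≤ C * Real.exp (-σ * (y - R)) * Real.exp (a / 2 * t) := fun t ht =>
    abs_le.2 ⟨by linarith [key (-1) (by simp) t ht], by linarith [key 1 (by simp) t ht]⟩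
  rcases ht.lt_or_eq with ht | rfl
  · exact hneg t ht
  · have h1 := h.continuous_time y
    have hl : Tendsto (fun t => |u t y|) (nhdsWithin 0 (Iio 0)) (nhds |u 0 y|) :=
      (Continuous.tendsto (by fun_prop) 0).mono_left nhdsWithin_le_nhds
    have hr : Tendsto (fun t => C * Real.exp (-σ * (y - R)) * Real.exp (a / 2 * t))
        (nhdsWithin 0 (Iio 0)) (nhds (C * Real.exp (-σ * (y - R)) * Real.exp (a / 2 * 0))) :=
      (Continuous.tendsto (by fun_prop) 0).mono_left nhdsWithin_le_nhds
    exact le_of_tendsto_of_tendsto hl hr (eventually_mem_nhdsWithin.mono hneg)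

theorem IsPointwiseSolution.comp_neg {V : ℝ → ℝ} {u ux uxx : ℝ → ℝ → ℝ}
    (h : IsPointwiseSolution V u ux uxx) :
    IsPointwiseSolution (fun x => V (-x)) (fun t x => u t (-x)) (fun t x => -ux t (-x))
      fun t x => uxx t (-x) where
  continuous_time x := h.continuous_time (-x)
  hasDerivAt_space t x :=
    ((h.hasDerivAt_space t (-x)).comp x (hasDerivAt_neg x)).congr_deriv (by simp)
  hasDerivAt_space' t x :=
    ((h.hasDerivAt_space' t (-x)).comp x (hasDerivAt_neg x)).neg.congr_deriv (by simp)
  continuous_uxx t := (h.continuous_uxx t).comp continuous_neg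
  hasDerivAt_time t ht x := h.hasDerivAt_time t ht (-x)

/-- A solution decaying exponentially backward in time also decays exponentially in space. -/
theorem IsPointwiseSolution.exists_abs_le_exp {V : ℝ → ℝ} {u ux uxx : ℝ → ℝ → ℝ}
    (h : IsPointwiseSolution V u ux uxx) (hu : Continuous (Function.uncurry u)) {a C R σ : ℝ}
    (ha : 0 < a) (hσ : 0 < σ) (hσa : σ ^ 2 = a / 16)
    (hV : ∀ x, R ≤ |x| → |V x| ≤ a / 4) (hC : ∀ t x, |u t x| ≤ C * Real.exp (a * min t 0))
    (hcl : ∀ t, u (min t 0) = u t) :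
    ∃ D, ∀ t x, |u t x| ≤ D * Real.exp (-σ * |x|) * Real.exp (a / 2 * min t 0) := by
  have hC0 : 0 ≤ C := nonneg_of_mul_nonneg_left ((abs_nonneg _).trans (hC 0 0)) (Real.exp_pos _)
  have hshift : ∀ y : ℝ, C * Real.exp (-σ * (y - R)) = C * Real.exp (σ * R) * Real.exp (-σ * y) :=
    fun y => by rw [mul_assoc, ← Real.exp_add]; ring_nf
  refine ⟨C * Real.exp (σ * R), fun t x => ?_⟩
  have ht : min t 0 ≤ 0 := min_le_right t 0
  have htt : min (min t 0) 0 = min t 0 := min_eq_left ht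
  rw [← hcl t, ← hshift]
  rcases le_or_gt R |x| with hx | hx
  · rcases le_total 0 x with h0 | h0
    · rw [abs_of_nonneg h0] at hx ⊢
      exact abs_le_exp_of_le h hu ha hσ hσa
        (fun y hy => hV y (hy.trans (le_abs_self y))) hC ht hx
    · rw [abs_of_nonpos h0] at hx ⊢
      have h1 : Continuous fun p : ℝ × ℝ => u p.1 p.2 := hu
      have := abs_le_exp_of_le h.comp_neg (by
          change Continuous fun p : ℝ × ℝ => u p.1 (-p.2)
          exact h1.comp (continuous_fst.prodMk continuous_snd.neg)) ha hσ hσa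
        (fun y hy => hV (-y) (by rw [abs_neg]; exact hy.trans (le_abs_self y)))
        (fun t x => hC t (-x)) ht hx
      simpa only [neg_neg] using this
  · refine (hC (min t 0) x).trans ?_
    rw [htt]
    have h1 : Real.exp (a * min t 0) ≤ Real.exp (a / 2 * min t 0) :=
      Real.exp_le_exp.2 (by nlinarith)
    have h2 : 1 ≤ Real.exp (-σ * (|x| - R)) := Real.one_le_exp (by nlinarith)
    rw [mul_assoc]
    refine mul_le_mul_of_nonneg_left (h1.trans ?_) hC0
    exact le_mul_of_one_le_left (Real.exp_pos _).le h2

/-- `g` decays exponentially at rate `σ`. -/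
def ExpBounded (σ K : ℝ) (g : ℝ → ℝ) : Prop := ∀ x, |g x| ≤ K * Real.exp (-σ * |x|)

theorem integrable_exp_neg_mul_abs {σ : ℝ} (hσ : 0 < σ) :
    MeasureTheory.Integrable fun x : ℝ => Real.exp (-σ * |x|) := by
  rw [← MeasureTheory.integrableOn_univ, ← Iic_union_Ioi (a := (0 : ℝ))]
  refine MeasureTheory.IntegrableOn.union ?_ ?_
  · refine (integrableOn_exp_mul_Iic hσ 0).congr_fun (fun x hx => ?_) measurableSet_Iic
    simp [abs_of_nonpos (show x ≤ 0 from hx)]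
  · refine (integrableOn_exp_mul_Ioi (neg_neg_iff_pos.2 hσ) 0).congr_fun (fun x hx => ?_)
      measurableSet_Ioi
    simp [abs_of_pos (show 0 < x from hx)]

namespace ExpBounded

variable {σ K K₁ K₂ : ℝ} {g h : ℝ → ℝ}

theorem nonneg (hg : ExpBounded σ K g) : 0 ≤ K :=
  nonneg_of_mul_nonneg_left ((abs_nonneg _).trans (hg 0)) (Real.exp_pos _)

theorem mono (hg : ExpBounded σ K₁ g) (hK : K₁ ≤ K₂) : ExpBounded σ K₂ g := fun x =>
  (hg x).trans (mul_le_mul_of_nonneg_right hK (Real.exp_pos _).le)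

theorem add (hg : ExpBounded σ K₁ g) (hh : ExpBounded σ K₂ h) :
    ExpBounded σ (K₁ + K₂) fun x => g x + h x := fun x => by
  rw [add_mul]
  exact (abs_add_le _ _).trans (add_le_add (hg x) (hh x))

theorem sub (hg : ExpBounded σ K₁ g) (hh : ExpBounded σ K₂ h) :
    ExpBounded σ (K₁ + K₂) fun x => g x - h x := fun x => by
  rw [add_mul]
  exact (abs_sub _ _).trans (add_le_add (hg x) (hh x))

theorem neg (hg : ExpBounded σ K g) : ExpBounded σ K fun x => -g x := fun x => by
  rw [abs_neg]
  exact hg x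

theorem bounded_mul (hh : ∀ x, |h x| ≤ K₁) (hg : ExpBounded σ K₂ g) :
    ExpBounded σ (K₁ * K₂) fun x => h x * g x := fun x => by
  rw [abs_mul, mul_assoc]
  exact mul_le_mul (hh x) (hg x) (abs_nonneg _) ((abs_nonneg _).trans (hh x))

theorem bounded (hσ : 0 ≤ σ) (hg : ExpBounded σ K g) (x : ℝ) : |g x| ≤ K :=
  (hg x).trans (mul_le_of_le_one_right hg.nonneg (Real.exp_le_one_iff.2
    (mul_nonpos_of_nonpos_of_nonneg (neg_nonpos.2 hσ) (abs_nonneg x))))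

theorem mul (hσ : 0 ≤ σ) (hg : ExpBounded σ K₁ g) (hh : ExpBounded σ K₂ h) :
    ExpBounded σ (K₁ * K₂) fun x => g x * h x := bounded_mul (hg.bounded hσ) hh

theorem integrable (hσ : 0 < σ) (hg : ExpBounded σ K g) (hc : Continuous g) :
    MeasureTheory.Integrable g :=
  ((integrable_exp_neg_mul_abs hσ).const_mul K).mono' hc.aestronglyMeasurable
    (Eventually.of_forall hg)

theorem deriv_of_second {g g' g'' : ℝ → ℝ} (hσ : 0 < σ) (hg : ∀ x, HasDerivAt g (g' x) x)
    (hg' : ∀ x, HasDerivAt g' (g'' x) x) (hb : ExpBounded σ K₁ g) (hb'' : ExpBounded σ K₂ g'') :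
    ExpBounded σ ((2 * K₁ + K₂) * Real.exp σ) g' := by
  intro x
  have hK₁ := hb.nonneg
  have hK₂ := hb''.nonneg
  have hloc : ∀ y ∈ Icc x (x + 1),
      Real.exp (-σ * |y|) ≤ Real.exp σ * Real.exp (-σ * |x|) := fun y hy => by
    rw [← Real.exp_add]
    refine Real.exp_le_exp.2 ?_
    have h1 := abs_sub_abs_le_abs_sub x y
    have h2 : |x - y| ≤ 1 := abs_le.2 ⟨by linarith [hy.2], by linarith [hy.1]⟩
    nlinarith
  obtain ⟨ξ, hξ, hξe⟩ := exists_hasDerivAt_eq_slope g g' (by linarith : x < x + 1)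
    (continuous_iff_continuousAt.2 fun x => (hg x).continuousAt).continuousOn fun x _ => hg x
  have hE := Real.exp_pos (-σ * |x|)
  have h1 : |g' ξ| ≤ 2 * K₁ * (Real.exp σ * Real.exp (-σ * |x|)) := by
    rw [hξe]
    have e : x + 1 - x = 1 := by ring
    rw [e, div_one]
    refine (abs_sub _ _).trans ?_
    have h2 := (hb x).trans (mul_le_mul_of_nonneg_left (hloc x ⟨le_rfl, by linarith⟩) hK₁)
    have h3 := (hb (x + 1)).trans
      (mul_le_mul_of_nonneg_left (hloc (x + 1) ⟨by linarith, le_rfl⟩) hK₁)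
    linarith
  have h2 : |g' x - g' ξ| ≤ K₂ * (Real.exp σ * Real.exp (-σ * |x|)) * |x - ξ| := by
    have := Convex.norm_image_sub_le_of_norm_hasDerivWithin_le (f := g') (f' := g'')
      (s := Icc x (x + 1)) (C := K₂ * (Real.exp σ * Real.exp (-σ * |x|))) (x := ξ)
      (y := x) (fun y _ => (hg' y).hasDerivWithinAt)
      (fun y hy => (hb'' y).trans (mul_le_mul_of_nonneg_left (hloc y hy) hK₂))
      (convex_Icc _ _) ⟨hξ.1.le, hξ.2.le⟩ ⟨le_rfl, by linarith⟩
    simpa using this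
  have h3 : |x - ξ| ≤ 1 := abs_le.2 ⟨by linarith [hξ.2], by linarith [hξ.1]⟩
  have h4 := h2.trans (mul_le_of_le_one_right (by positivity) h3)
  have h5 := abs_sub_abs_le_abs_sub (g' x) (g' ξ)
  linarith

end ExpBounded

/-- A twice continuously differentiable function that decays exponentially together with its
second derivative. -/
structure ExpDecayC2 (σ : ℝ) (g g' g'' : ℝ → ℝ) : Prop where
  hasDerivAt : ∀ x, HasDerivAt g (g' x) x
  hasDerivAt' : ∀ x, HasDerivAt g' (g'' x) x
  continuous'' : Continuous g''
  bound : ∃ K, ExpBounded σ K g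
  bound'' : ∃ K, ExpBounded σ K g''

namespace ExpDecayC2

variable {σ : ℝ} {g g' g'' h h' h'' : ℝ → ℝ}

theorem continuous (hg : ExpDecayC2 σ g g' g'') : Continuous g :=
  continuous_iff_continuousAt.2 fun x => (hg.hasDerivAt x).continuousAt

theorem continuous' (hg : ExpDecayC2 σ g g' g'') : Continuous g' :=
  continuous_iff_continuousAt.2 fun x => (hg.hasDerivAt' x).continuousAt

theorem bound' (hσ : 0 < σ) (hg : ExpDecayC2 σ g g' g'') : ∃ K, ExpBounded σ K g' :=
  let ⟨_, h1⟩ := hg.bound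
  let ⟨_, h2⟩ := hg.bound''
  ⟨_, ExpBounded.deriv_of_second hσ hg.hasDerivAt hg.hasDerivAt' h1 h2⟩

theorem integral_mul_second_deriv (hσ : 0 < σ) (hg : ExpDecayC2 σ g g' g'')
    (hh : ExpDecayC2 σ h h' h'') : ∫ x, g x * h'' x = -∫ x, g' x * h' x := by
  obtain ⟨_, g0⟩ := hg.bound
  obtain ⟨_, g1⟩ := hg.bound' hσ
  obtain ⟨_, h1⟩ := hh.bound' hσ
  obtain ⟨_, h2⟩ := hh.bound''
  exact MeasureTheory.integral_mul_deriv_eq_deriv_mul_of_integrable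
    (fun x _ => hg.hasDerivAt x) (fun x _ => hh.hasDerivAt' x)
    ((g0.mul hσ.le h2).integrable hσ (hg.continuous.mul hh.continuous''))
    ((g1.mul hσ.le h1).integrable hσ (hg.continuous'.mul hh.continuous'))
    ((g0.mul hσ.le h1).integrable hσ (hg.continuous.mul hh.continuous'))

theorem integral_mul_second_deriv_comm (hσ : 0 < σ) (hg : ExpDecayC2 σ g g' g'')
    (hh : ExpDecayC2 σ h h' h'') : ∫ x, g x * h'' x = ∫ x, g'' x * h x := by
  rw [integral_mul_second_deriv hσ hg hh]
  simp only [mul_comm (g'' _)]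
  rw [integral_mul_second_deriv hσ hh hg]
  simp only [mul_comm]

end ExpDecayC2

/-- A Poincaré inequality on a short interval at the right end of which `z` vanishes. -/
theorem integral_sq_deriv_sub_nonneg {z z' : ℝ → ℝ} (hz : ∀ x, HasDerivAt z (z' x) x)
    (hz' : Continuous z') {α β Λ : ℝ} (hΛ : 0 ≤ Λ) (hαβ : α ≤ β) (hs : 4 * Λ * (β - α) ^ 2 ≤ 1)
    (hβ : z β = 0) : 0 ≤ ∫ x in α..β, (z' x ^ 2 - Λ * z x ^ 2) := by
  have hzc : Continuous z := continuous_iff_continuousAt.2 fun x => (hz x).continuousAt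
  have hd : ∀ x, HasDerivAt (fun x => -2 * Λ * (x - α) * z x ^ 2)
      (-2 * Λ * z x ^ 2 + -2 * Λ * (x - α) * (2 * z x * z' x)) x := fun x => by
    refine ((((hasDerivAt_id x).sub_const α).const_mul (-2 * Λ)).mul
      ((hz x).pow 2)).congr_deriv ?_
    simp
  have hc : Continuous fun x => -2 * Λ * z x ^ 2 + -2 * Λ * (x - α) * (2 * z x * z' x) := by
    fun_prop
  have h0 := intervalIntegral.integral_eq_sub_of_hasDerivAt (a := α) (b := β)
    (fun x _ => hd x) (hc.intervalIntegrable _ _)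
  rw [hβ] at h0
  have h1 : (0 : ℝ) = ∫ x in α..β, (-2 * Λ * z x ^ 2 + -2 * Λ * (x - α) * (2 * z x * z' x)) := by
    rw [h0]
    ring
  rw [h1]
  refine intervalIntegral.integral_mono_on hαβ (hc.intervalIntegrable _ _)
    (Continuous.intervalIntegrable (by fun_prop) _ _) fun x hx => ?_
  have h2 : (x - α) ^ 2 ≤ (β - α) ^ 2 :=
    pow_le_pow_left₀ (by linarith [hx.1]) (by linarith [hx.2]) 2
  have h3 : 4 * Λ * (x - α) ^ 2 ≤ 1 := (mul_le_mul_of_nonneg_left h2 (by positivity)).trans hs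
  have h4 : 0 ≤ Λ * (1 - 4 * Λ * (x - α) ^ 2) * z x ^ 2 :=
    mul_nonneg (mul_nonneg hΛ (by linarith)) (sq_nonneg _)
  nlinarith [sq_nonneg (z' x + 2 * Λ * (x - α) * z x)]

theorem integral_sq_deriv_sub_nonneg_of_grid {z z' : ℝ → ℝ} (hz : ∀ x, HasDerivAt z (z' x) x)
    (hz' : Continuous z') {Λ ℓ α : ℝ} (hΛ : 0 ≤ Λ) (hℓ : 0 ≤ ℓ) (hs : 4 * Λ * ℓ ^ 2 ≤ 1) {n : ℕ}
    (hzero : ∀ j ≤ n, z (α + j * ℓ) = 0) :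
    0 ≤ ∫ x in α..(α + n * ℓ), (z' x ^ 2 - Λ * z x ^ 2) := by
  have hzc : Continuous z := continuous_iff_continuousAt.2 fun x => (hz x).continuousAt
  have hc : Continuous fun x => z' x ^ 2 - Λ * z x ^ 2 := by fun_prop
  have hsum := intervalIntegral.sum_integral_adjacent_intervals (μ := MeasureTheory.volume)
    (a := fun j : ℕ => α + j * ℓ) (n := n) fun k _ => hc.intervalIntegrable _ _
  simp only [Nat.cast_zero, zero_mul, add_zero] at hsum
  rw [← hsum]
  refine Finset.sum_nonneg fun j hj => ?_
  have e : α + ((j + 1 : ℕ) : ℝ) * ℓ - (α + j * ℓ) = ℓ := by push_cast; ring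
  exact integral_sq_deriv_sub_nonneg hz hz' hΛ (by linarith) (by rwa [e])
    (hzero (j + 1) (Finset.mem_range.1 hj))

/-- The quadratic form `∫ z'² + W z²` is positive on functions vanishing on a fine grid, if
`W` is positive away from the grid. -/
theorem eq_zero_of_energy_nonpos {z z' W : ℝ → ℝ} (hz : ∀ x, HasDerivAt z (z' x) x)
    (hz' : Continuous z') (hW : Continuous W) {Λ κ R ℓ : ℝ} (hΛ : 0 ≤ Λ) (hκ : 0 < κ) (hℓ : 0 ≤ ℓ)
    (hs : 4 * (Λ + κ) * ℓ ^ 2 ≤ 1) {n : ℕ} (hn : n * ℓ = 2 * R)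
    (hzero : ∀ j ≤ n, z (-R + j * ℓ) = 0) (hWΛ : ∀ x, -Λ ≤ W x) (hWκ : ∀ x, R ≤ |x| → κ ≤ W x)
    (hi : MeasureTheory.Integrable fun x => z' x ^ 2 + W x * z x ^ 2)
    (hi2 : MeasureTheory.Integrable fun x => z x ^ 2)
    (hle : ∫ x, (z' x ^ 2 + W x * z x ^ 2) ≤ 0) : ∀ x, z x = 0 := by
  have hzc : Continuous z := continuous_iff_continuousAt.2 fun x => (hz x).continuousAt
  have hRR : -R ≤ R := by
    have : (0 : ℝ) ≤ n * ℓ := by positivity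
    linarith
  have hH : MeasureTheory.Integrable fun x => z' x ^ 2 + W x * z x ^ 2 - κ * z x ^ 2 :=
    hi.sub (hi2.const_mul κ)
  have hmain : 0 ≤ ∫ x, (z' x ^ 2 + W x * z x ^ 2 - κ * z x ^ 2) := by
    rw [← MeasureTheory.integral_add_compl (measurableSet_Ioc (a := -R) (b := R)) hH]
    refine add_nonneg ?_ (MeasureTheory.setIntegral_nonneg measurableSet_Ioc.compl fun x hx => ?_)
    · rw [← intervalIntegral.integral_of_le hRR]
      have h1 := integral_sq_deriv_sub_nonneg_of_grid hz hz' (add_nonneg hΛ hκ.le) hℓ hs hzero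
      rw [hn, (by ring : -R + 2 * R = R)] at h1
      refine h1.trans (intervalIntegral.integral_mono_on hRR
        (Continuous.intervalIntegrable (by fun_prop) _ _)
        (Continuous.intervalIntegrable (by fun_prop) _ _) fun x _ => ?_)
      have := mul_le_mul_of_nonneg_right (hWΛ x) (sq_nonneg (z x))
      linarith
    · have hx' : R ≤ |x| := by
        by_contra! hlt
        exact hx ⟨(abs_lt.1 hlt).1, (abs_lt.1 hlt).2.le⟩
      have := mul_le_mul_of_nonneg_right (hWκ x hx') (sq_nonneg (z x))
      linarith [sq_nonneg (z' x)]
  rw [MeasureTheory.integral_sub hi (hi2.const_mul κ), MeasureTheory.integral_const_mul] at hmain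
  have hint : ∫ x, z x ^ 2 = 0 := by
    refine le_antisymm ?_ (MeasureTheory.integral_nonneg fun x => sq_nonneg _)
    by_contra! hpos
    have := mul_pos hκ hpos
    linarith
  have hae := (MeasureTheory.integral_eq_zero_iff_of_nonneg (fun x => sq_nonneg (z x)) hi2).1 hint
  have := (Continuous.ae_eq_iff_eq MeasureTheory.volume (by fun_prop) continuous_const).1 hae
  exact fun x => pow_eq_zero_iff two_ne_zero |>.1 (congrFun this x)

theorem hasDerivAt_integral_mul {σ K₁ K₂ K₃ K₄ : ℝ} (hσ : 0 < σ) {A A' B B' : ℝ → ℝ → ℝ}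
    (hA : ∀ t x, HasDerivAt (fun s => A s x) (A' t x) t)
    (hB : ∀ t x, HasDerivAt (fun s => B s x) (B' t x) t)
    (hAc : ∀ t, Continuous (A t)) (hAc' : ∀ t, Continuous (A' t))
    (hBc : ∀ t, Continuous (B t)) (hBc' : ∀ t, Continuous (B' t))
    (hAb : ∀ t, ExpBounded σ K₁ (A t)) (hAb' : ∀ t, ExpBounded σ K₂ (A' t))
    (hBb : ∀ t, ExpBounded σ K₃ (B t)) (hBb' : ∀ t, ExpBounded σ K₄ (B' t)) (t : ℝ) :
    HasDerivAt (fun s => ∫ x, A s x * B s x) (∫ x, (A' t x * B t x + A t x * B' t x)) t := by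
  refine (hasDerivAt_integral_of_dominated_loc_of_deriv_le (μ := MeasureTheory.volume)
    (F := fun s x => A s x * B s x) (F' := fun s x => A' s x * B s x + A s x * B' s x)
    (bound := fun x => (K₂ * K₃ + K₁ * K₄) * Real.exp (-σ * |x|)) univ_mem ?_ ?_ ?_ ?_ ?_ ?_).2
  · exact Eventually.of_forall fun s => ((hAc s).mul (hBc s)).aestronglyMeasurable
  · exact ((hAb t).mul hσ.le (hBb t)).integrable hσ ((hAc t).mul (hBc t))
  · exact (((hAc' t).mul (hBc t)).add ((hAc t).mul (hBc' t))).aestronglyMeasurable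
  · exact Eventually.of_forall fun x s _ =>
      ((hAb' s).mul hσ.le (hBb s)).add ((hAb s).mul hσ.le (hBb' s)) x
  · exact (integrable_exp_neg_mul_abs hσ).const_mul _
  · exact Eventually.of_forall fun x s _ => (hA s x).mul (hB s x)

theorem integral_mul_sq_le {f g : ℝ → ℝ} (hff : MeasureTheory.Integrable fun x => f x * f x)
    (hfg : MeasureTheory.Integrable fun x => f x * g x)
    (hgg : MeasureTheory.Integrable fun x => g x * g x) :
    (∫ x, f x * g x) ^ 2 ≤ (∫ x, f x * f x) * ∫ x, g x * g x := by
  have key : ∀ k : ℝ, 0 ≤ (∫ x, g x * g x) * (k * k) + (2 * ∫ x, f x * g x) * k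
      + ∫ x, f x * f x := fun k => by
    have h1 : 0 ≤ ∫ x, (f x * f x + 2 * k * (f x * g x) + k * k * (g x * g x)) :=
      MeasureTheory.integral_nonneg fun x => by
        change 0 ≤ f x * f x + 2 * k * (f x * g x) + k * k * (g x * g x)
        nlinarith [sq_nonneg (f x + k * g x)]
    have hI : MeasureTheory.Integrable fun x => f x * f x + 2 * k * (f x * g x) :=
      hff.add (hfg.const_mul _)
    rw [MeasureTheory.integral_add hI (hgg.const_mul _),
      MeasureTheory.integral_add hff (hfg.const_mul _), MeasureTheory.integral_const_mul,
      MeasureTheory.integral_const_mul] at h1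
    linarith
  have := discrim_le_zero key
  rw [discrim] at this
  linarith

/-- A log-convex sequence bounded by a geometric sequence decays at each step at the geometric
rate. -/
theorem le_mul_of_logConvex {n : ℕ → ℝ} (h0 : ∀ k, 0 ≤ n k)
    (hconv : ∀ k, n (k + 1) ^ 2 ≤ n k * n (k + 2)) {K q : ℝ} (hq : 0 < q)
    (hK : ∀ k, n k ≤ K * q ^ k) : n 1 ≤ q * n 0 := by
  rcases (h0 0).eq_or_lt with hz | hpos
  · have h1 : n 1 ^ 2 ≤ n 0 * n 2 := hconv 0
    rw [← hz, zero_mul] at h1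
    rw [← hz, mul_zero]
    exact (pow_eq_zero_iff two_ne_zero |>.1 (le_antisymm h1 (sq_nonneg _))).le
  by_contra! hlt
  set ρ := n 1 / n 0 with hρ
  have hqρ : q < ρ := by rwa [hρ, lt_div_iff₀ hpos]
  have hρ0 : 0 < ρ := hq.trans hqρ
  have hstep : ∀ k, 0 < n k ∧ ρ * n k ≤ n (k + 1) := by
    intro k
    induction k with
    | zero => exact ⟨hpos, by rw [hρ, div_mul_cancel₀ _ hpos.ne']⟩
    | succ k ih =>
      have hp : 0 < n (k + 1) := (mul_pos hρ0 ih.1).trans_le ih.2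
      refine ⟨hp, ?_⟩
      have h2 : n k * (ρ * n (k + 1)) ≤ n k * n (k + 2) := by
        refine le_trans ?_ (hconv k)
        nlinarith [mul_le_mul_of_nonneg_right ih.2 hp.le]
      exact le_of_mul_le_mul_left h2 ih.1
  have hgeo : ∀ k, ρ ^ k * n 0 ≤ n k := by
    intro k
    induction k with
    | zero => simp
    | succ k ih =>
      refine le_trans ?_ (hstep k).2
      rw [pow_succ', mul_assoc]
      exact mul_le_mul_of_nonneg_left ih hρ0.le
  have hr : 1 < ρ / q := by rwa [one_lt_div hq]
  obtain ⟨k, hk⟩ := ((tendsto_pow_atTop_atTop_of_one_lt hr).eventually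
    (eventually_gt_atTop (K / n 0))).exists
  rw [div_lt_iff₀ hpos, div_pow, div_mul_eq_mul_div, lt_div_iff₀ (pow_pos hq k)] at hk
  linarith [hgeo k, hK k]

/-- A solution of `∂Y/∂t = ∂²Y/∂x² - V Y` on `t ≤ 0`, extended to a neighbourhood of `t = 0`, that
decays exponentially backward in time and in space. -/
structure IsExpDecaySolution (V : ℝ → ℝ) (σ b K K' : ℝ) (Y Y' : ℝ → ℝ → ℝ) : Prop where
  hasDerivAt_time : ∀ t x, HasDerivAt (fun s => Y s x) (Y' t x) t
  continuous : ∀ t, Continuous (Y t)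
  continuous' : ∀ t, Continuous (Y' t)
  bound : ∀ t, ExpBounded σ (K * Real.exp (b * min t 0)) (Y t)
  bound' : ∀ t, ExpBounded σ K' (Y' t)
  expDecayC2 : ∀ t ≤ 0, ∃ g', ExpDecayC2 σ (Y t) g' fun x => V x * Y t x + Y' t x

namespace IsExpDecaySolution

variable {V : ℝ → ℝ} {σ b K K' : ℝ} {Y Y' : ℝ → ℝ → ℝ}

theorem bound_const (h : IsExpDecaySolution V σ b K K' Y Y') (hb : 0 ≤ b) (t : ℝ) :
    ExpBounded σ K (Y t) := by
  have hK : 0 ≤ K := nonneg_of_mul_nonneg_left (h.bound 0).nonneg (Real.exp_pos _)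
  exact (h.bound t).mono (mul_le_of_le_one_right hK (exp_mul_min_le_one hb t))

theorem integrable_mul (h : IsExpDecaySolution V σ b K K' Y Y') (hσ : 0 < σ) (s t : ℝ) :
    MeasureTheory.Integrable fun x => Y s x * Y t x :=
  ((h.bound s).mul hσ.le (h.bound t)).integrable hσ ((h.continuous s).mul (h.continuous t))

theorem integrable_mul_deriv (h : IsExpDecaySolution V σ b K K' Y Y') (hσ : 0 < σ) (s t : ℝ) :
    MeasureTheory.Integrable fun x => Y s x * Y' t x :=
  ((h.bound s).mul hσ.le (h.bound' t)).integrable hσ ((h.continuous s).mul (h.continuous' t))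

theorem integrable_potential (h : IsExpDecaySolution V σ b K K' Y Y') (hσ : 0 < σ)
    (hV : Continuous V) {Λ : ℝ} (hΛ : ∀ x, |V x| ≤ Λ) (s t : ℝ) :
    MeasureTheory.Integrable fun x => V x * (Y s x * Y t x) :=
  (ExpBounded.bounded_mul hΛ ((h.bound s).mul hσ.le (h.bound t))).integrable hσ
    (hV.mul ((h.continuous s).mul (h.continuous t)))

theorem integral_mul_deriv_comm (h : IsExpDecaySolution V σ b K K' Y Y') (hσ : 0 < σ)
    (hV : Continuous V) {Λ : ℝ} (hΛ : ∀ x, |V x| ≤ Λ) {s t : ℝ} (hs : s ≤ 0) (ht : t ≤ 0) :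
    ∫ x, Y s x * Y' t x = ∫ x, Y t x * Y' s x := by
  obtain ⟨_, h1⟩ := h.expDecayC2 s hs
  obtain ⟨_, h2⟩ := h.expDecayC2 t ht
  have e := h1.integral_mul_second_deriv_comm hσ h2
  have e1 : ∀ x, Y s x * (V x * Y t x + Y' t x) = V x * (Y s x * Y t x) + Y s x * Y' t x :=
    fun x => by ring
  have e2 : ∀ x, (V x * Y s x + Y' s x) * Y t x = V x * (Y s x * Y t x) + Y t x * Y' s x :=
    fun x => by ring
  simp only [e1, e2] at e
  rw [MeasureTheory.integral_add (h.integrable_potential hσ hV hΛ s t)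
      (h.integrable_mul_deriv hσ s t),
    MeasureTheory.integral_add (h.integrable_potential hσ hV hΛ s t)
      (h.integrable_mul_deriv hσ t s)] at e
  linarith

theorem integral_mul_eq (h : IsExpDecaySolution V σ b K K' Y Y') (hσ : 0 < σ) (hb : 0 ≤ b)
    (hV : Continuous V) {Λ : ℝ} (hΛ : ∀ x, |V x| ≤ Λ) {m r : ℝ} (hr : 0 ≤ r) (hmr : m + r ≤ 0) :
    ∫ x, Y (m + r) x * Y (m - r) x = ∫ x, Y m x * Y m x := by
  have hd : ∀ t, HasDerivAt (fun s => ∫ x, Y (m + s) x * Y (m - s) x)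
      (∫ x, (Y' (m + t) x * Y (m - t) x + Y (m + t) x * -Y' (m - t) x)) t := by
    refine hasDerivAt_integral_mul hσ
      (A := fun s => Y (m + s)) (A' := fun s => Y' (m + s)) (B := fun s => Y (m - s))
      (B' := fun s x => -Y' (m - s) x) (fun t x => ?_) (fun t x => ?_)
      (fun t => h.continuous _) (fun t => h.continuous' _) (fun t => h.continuous _)
      (fun t => (h.continuous' _).neg) (fun t => h.bound_const hb _) (fun t => h.bound' _)
      (fun t => h.bound_const hb _) (fun t => (h.bound' _).neg)
    · exact (h.hasDerivAt_time (m + t) x).comp_const_add m t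
    · exact (h.hasDerivAt_time (m - t) x).comp_const_sub m t
  have h0 : ∀ t ∈ Ico 0 r,
      ∫ x, (Y' (m + t) x * Y (m - t) x + Y (m + t) x * -Y' (m - t) x) = 0 := by
    intro t ht
    have e : ∀ x, Y' (m + t) x * Y (m - t) x + Y (m + t) x * -Y' (m - t) x
        = Y (m - t) x * Y' (m + t) x - Y (m + t) x * Y' (m - t) x := fun x => by ring
    simp only [e]
    rw [MeasureTheory.integral_sub (h.integrable_mul_deriv hσ _ _) (h.integrable_mul_deriv hσ _ _),
      h.integral_mul_deriv_comm hσ hV hΛ (s := m - t) (t := m + t) (by linarith [ht.1, ht.2])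
        (by linarith [ht.1, ht.2]), sub_self]
  have hconst := constant_of_has_deriv_right_zero
    (f := fun s => ∫ x, Y (m + s) x * Y (m - s) x) (a := 0) (b := r)
    (continuous_iff_continuousAt.2 fun t => (hd t).continuousAt).continuousOn
    (fun t ht => h0 t ht ▸ (hd t).hasDerivWithinAt) r ⟨hr, le_rfl⟩
  simpa using hconst

theorem integral_sq_sub_le (h : IsExpDecaySolution V σ b K K' Y Y') (hσ : 0 < σ) (hb : 0 ≤ b)
    (hV : Continuous V) {Λ : ℝ} (hΛ : ∀ x, |V x| ≤ Λ) {t r : ℝ} (hr : 0 ≤ r) (ht : t ≤ 0) :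
    ∫ x, Y (t - r) x * Y (t - r) x ≤ Real.exp (-(2 * b * r)) * ∫ x, Y t x * Y t x := by
  have key := le_mul_of_logConvex (n := fun k : ℕ => ∫ x, Y (t - k * r) x * Y (t - k * r) x)
    (q := Real.exp (-(2 * b * r))) (K := K ^ 2 * ∫ x, Real.exp (-σ * |x|))
    (fun k => MeasureTheory.integral_nonneg fun x => mul_self_nonneg _) (fun k => ?_)
    (Real.exp_pos _) fun k => ?_
  · simpa using key
  · have e := h.integral_mul_eq hσ hb hV hΛ (m := t - ((k + 1 : ℕ) : ℝ) * r) hr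
      (by push_cast; nlinarith [mul_nonneg (Nat.cast_nonneg (α := ℝ) k) hr])
    have e1 : t - ((k + 1 : ℕ) : ℝ) * r + r = t - k * r := by push_cast; ring
    have e2 : t - ((k + 1 : ℕ) : ℝ) * r - r = t - ((k + 2 : ℕ) : ℝ) * r := by push_cast; ring
    rw [e1, e2] at e
    rw [← e]
    exact integral_mul_sq_le (h.integrable_mul hσ _ _) (h.integrable_mul hσ _ _)
      (h.integrable_mul hσ _ _)
  · have hkr : 0 ≤ (k : ℝ) * r := by positivity
    have hK : 0 ≤ K := nonneg_of_mul_nonneg_left (h.bound 0).nonneg (Real.exp_pos _)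
    set B := K * Real.exp (b * min (t - k * r) 0) with hB
    have hB0 : 0 ≤ B := (h.bound _).nonneg
    have h1 : B ≤ K * Real.exp (-(b * (k * r))) := by
      refine mul_le_mul_of_nonneg_left (Real.exp_le_exp.2 ?_) hK
      rw [min_eq_left (by linarith)]
      nlinarith
    have h2 : B * B ≤ K ^ 2 * Real.exp (-(2 * b * r)) ^ k := by
      refine (mul_le_mul h1 h1 hB0 (hB0.trans h1)).trans_eq ?_
      rw [← Real.exp_nat_mul, mul_mul_mul_comm, ← Real.exp_add, sq]
      congr 2
      ring
    have h3 := (h.bound (t - k * r)).mul hσ.le (h.bound (t - k * r))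
    calc ∫ x, Y (t - k * r) x * Y (t - k * r) x
        ≤ ∫ x, B * B * Real.exp (-σ * |x|) :=
          MeasureTheory.integral_mono (h.integrable_mul hσ _ _)
            ((integrable_exp_neg_mul_abs hσ).const_mul _) fun x => (le_abs_self _).trans (h3 x)
      _ = B * B * ∫ x, Real.exp (-σ * |x|) := MeasureTheory.integral_const_mul _ _
      _ ≤ K ^ 2 * Real.exp (-(2 * b * r)) ^ k * ∫ x, Real.exp (-σ * |x|) :=
          mul_le_mul_of_nonneg_right h2
            (MeasureTheory.integral_nonneg fun x => (Real.exp_pos _).le)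
      _ = K ^ 2 * (∫ x, Real.exp (-σ * |x|)) * Real.exp (-(2 * b * r)) ^ k := by ring

theorem mul_integral_sq_le (h : IsExpDecaySolution V σ b K K' Y Y') (hσ : 0 < σ) (hb : 0 ≤ b)
    (hV : Continuous V) {Λ : ℝ} (hΛ : ∀ x, |V x| ≤ Λ) :
    b * ∫ x, Y 0 x * Y 0 x ≤ ∫ x, Y 0 x * Y' 0 x := by
  have hd := hasDerivAt_integral_mul hσ h.hasDerivAt_time h.hasDerivAt_time h.continuous
    h.continuous' h.continuous h.continuous' (h.bound_const hb) h.bound' (h.bound_const hb)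
    h.bound' 0
  have e : ∀ x, Y' 0 x * Y 0 x + Y 0 x * Y' 0 x = 2 * (Y 0 x * Y' 0 x) := fun x => by ring
  simp only [e] at hd
  rw [MeasureTheory.integral_const_mul] at hd
  set n0 := ∫ x, Y 0 x * Y 0 x with hn0
  have hexp : HasDerivAt (fun s : ℝ => Real.exp (2 * b * s) * n0) (2 * b * n0) 0 := by
    refine ((((hasDerivAt_id (0 : ℝ)).const_mul (2 * b)).exp).mul_const n0).congr_deriv ?_
    simp
  have hsl := (hasDerivAt_iff_tendsto_slope_left_right.1 (hd.sub hexp)).1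
  have hnn : 0 ≤ 2 * (∫ x, Y 0 x * Y' 0 x) - 2 * b * n0 := by
    refine ge_of_tendsto hsl (eventually_mem_nhdsWithin.mono fun s hs => ?_)
    have hs0 : s < 0 := hs
    have h1 := h.integral_sq_sub_le hσ hb hV hΛ (t := 0) (r := -s) (by linarith) le_rfl
    have e1 : -(2 * b * -s) = 2 * b * s := by ring
    rw [zero_sub, neg_neg, e1] at h1
    rw [slope_def_field]
    refine div_nonneg_of_nonpos ?_ (by linarith)
    simp only [Pi.sub_apply, mul_zero, Real.exp_zero, one_mul]
    linarith
  linarith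

/-- An exponentially decaying solution vanishes if it vanishes at time `0` on a fine grid. -/
theorem eq_zero_of_grid (h : IsExpDecaySolution V σ b K K' Y Y') (hσ : 0 < σ) (hb : 0 < b)
    (hV : Continuous V) {Λ R ℓ : ℝ} (hΛ : ∀ x, |V x| ≤ Λ) (hℓ : 0 ≤ ℓ)
    (hs : 4 * (Λ + b / 2) * ℓ ^ 2 ≤ 1) {n : ℕ} (hn : n * ℓ = 2 * R)
    (hVR : ∀ x, R ≤ |x| → |V x| ≤ b / 2) (hzero : ∀ j ≤ n, Y 0 (-R + j * ℓ) = 0) :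
    ∀ t ≤ 0, ∀ x, Y t x = 0 := by
  obtain ⟨g', hg⟩ := h.expDecayC2 0 le_rfl
  have hIBP := hg.integral_mul_second_deriv hσ hg
  obtain ⟨_, hgb⟩ := hg.bound' hσ
  have hg2 : MeasureTheory.Integrable fun x => g' x ^ 2 := by
    simpa only [sq] using (hgb.mul hσ.le hgb).integrable hσ (hg.continuous'.mul hg.continuous')
  have hY2 : MeasureTheory.Integrable fun x => Y 0 x ^ 2 := by
    simpa only [sq] using h.integrable_mul hσ 0 0
  have hVY2 : MeasureTheory.Integrable fun x => V x * Y 0 x ^ 2 := by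
    simpa only [sq] using h.integrable_potential hσ hV hΛ 0 0
  have hrate := h.mul_integral_sq_le hσ hb.le hV hΛ
  have e1 : ∀ x, Y 0 x * (V x * Y 0 x + Y' 0 x) = V x * Y 0 x ^ 2 + Y 0 x * Y' 0 x :=
    fun x => by ring
  simp only [e1] at hIBP
  rw [MeasureTheory.integral_add hVY2 (h.integrable_mul_deriv hσ 0 0)] at hIBP
  simp only [← sq] at hIBP hrate
  have e2 : ∀ x, g' x ^ 2 + (V x + b) * Y 0 x ^ 2
      = g' x ^ 2 + (V x * Y 0 x ^ 2 + b * Y 0 x ^ 2) := fun x => by ring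
  have hVb : MeasureTheory.Integrable fun x => V x * Y 0 x ^ 2 + b * Y 0 x ^ 2 :=
    hVY2.add (hY2.const_mul b)
  have hzero0 : ∀ x, Y 0 x = 0 := by
    refine eq_zero_of_energy_nonpos (W := fun x => V x + b) (Λ := Λ) (κ := b / 2) hg.hasDerivAt
      hg.continuous' (by fun_prop) ((abs_nonneg _).trans (hΛ 0)) (by positivity) hℓ hs hn hzero
      (fun x => by linarith [neg_le_of_abs_le (hΛ x)])
      (fun x hx => by linarith [neg_le_of_abs_le (hVR x hx)]) ?_ hY2 ?_
    · simp only [e2]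
      exact hg2.add hVb
    · simp only [e2]
      rw [MeasureTheory.integral_add hg2 hVb,
        MeasureTheory.integral_add hVY2 (hY2.const_mul b), MeasureTheory.integral_const_mul]
      linarith
  intro t ht
  have h1 := h.integral_sq_sub_le hσ hb.le hV hΛ (t := 0) (r := -t) (by linarith) le_rfl
  simp only [hzero0, mul_zero, MeasureTheory.integral_zero, zero_sub, neg_neg] at h1
  have h2 : ∫ x, Y t x * Y t x = 0 :=
    le_antisymm h1 (MeasureTheory.integral_nonneg fun x => mul_self_nonneg _)
  have hae := (MeasureTheory.integral_eq_zero_iff_of_nonneg (fun x => mul_self_nonneg (Y t x))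
    (h.integrable_mul hσ t t)).1 h2
  have := (Continuous.ae_eq_iff_eq MeasureTheory.volume
    ((h.continuous t).mul (h.continuous t)) continuous_const).1 hae
  exact fun x => mul_self_eq_zero.1 (congrFun this x)

end IsExpDecaySolution

theorem eq_zero_of_timeAvg_eq_zero {w : ℝ → ℝ → ℝ} {x a C : ℝ} (ha : 0 < a)
    (hw : Continuous fun t => w t x) (hC : ∀ t, |w t x| ≤ C * Real.exp (a * min t 0))
    (h0 : ∀ t ≤ 0, timeAvg w t x = 0) : ∀ t ≤ 0, w t x = 0 := by
  have hper : ∀ t < 0, w t x = w (t - 1) x := by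
    intro t ht
    have h1 : HasDerivAt (fun s => timeAvg w s x) 0 t :=
      (hasDerivAt_const t (0 : ℝ)).congr_of_eventuallyEq
        (by filter_upwards [Iio_mem_nhds ht] with s hs using h0 s (le_of_lt hs))
    exact sub_eq_zero.1 ((hasDerivAt_timeAvg hw t).unique h1)
  have hiter : ∀ t < 0, ∀ k : ℕ, w t x = w (t - k) x := by
    intro t ht k
    induction k with
    | zero => simp
    | succ k ih =>
      rw [ih, hper (t - k) (by have : (0 : ℝ) ≤ k := k.cast_nonneg; linarith)]
      push_cast
      ring_nf
  have hneg : ∀ t < 0, w t x = 0 := by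
    intro t ht
    have hlim : Tendsto (fun k : ℕ => C * Real.exp (a * (t - k))) atTop (nhds 0) := by
      rw [← mul_zero C]
      refine (Real.tendsto_exp_atBot.comp ?_).const_mul C
      exact (tendsto_atBot_add_const_left _ t
        (tendsto_neg_atTop_atBot.comp tendsto_natCast_atTop_atTop)).const_mul_atBot ha
    have hle : |w t x| ≤ 0 := ge_of_tendsto' hlim fun k => by
      have hk : t - k ≤ 0 := by have : (0 : ℝ) ≤ k := k.cast_nonneg; linarith
      have := hC (t - k)
      rwa [← hiter t ht k, min_eq_left hk] at this
    exact abs_nonpos_iff.1 hle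
  have hcl : closure (Iio (0 : ℝ)) ⊆ {t | w t x = 0} :=
    closure_minimal hneg (isClosed_eq hw continuous_const)
  rw [closure_Iio] at hcl
  exact hcl

namespace IsPointwiseSolution

variable {V : ℝ → ℝ} {u ux uxx : ℝ → ℝ → ℝ}

theorem isExpDecaySolution_timeAvg (h : IsPointwiseSolution V u ux uxx) (hV : Continuous V)
    {Λ b σ D : ℝ} (hΛ : ∀ x, |V x| ≤ Λ) (hb : 0 ≤ b) (hσ : 0 < σ)
    (hD : ∀ t x, |u t x| ≤ D * Real.exp (-σ * |x|) * Real.exp (b * min t 0)) :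
    IsExpDecaySolution V σ b D (D + D) (timeAvg u) fun t x => u t x - u (t - 1) x := by
  have hD0 : 0 ≤ D := by
    have := (abs_nonneg _).trans (hD 0 0)
    simpa using this
  have hσE : ∀ x : ℝ, Real.exp (-σ * |x|) ≤ 1 := fun x =>
    Real.exp_le_one_iff.2 (by nlinarith [abs_nonneg x])
  have hbd : ∀ t, ExpBounded σ D (u t) := fun t x =>
    (hD t x).trans (mul_le_of_le_one_right (by positivity) (exp_mul_min_le_one hb t))
  have hM : ∀ t x, |u t x| ≤ D := fun t x =>
    (hbd t x).trans (mul_le_of_le_one_right hD0 (hσE x))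
  have hc := h.continuous_space
  have havg : ∀ t, ExpBounded σ (D * Real.exp (b * min t 0)) (timeAvg u t) := fun t x => by
    rw [mul_right_comm]
    exact abs_timeAvg_le_exp hb (hD · x) t
  refine ⟨fun t x => hasDerivAt_timeAvg (h.continuous_time x) t,
    continuous_timeAvg_space hc h.continuous_time hM, fun t => (hc t).sub (hc (t - 1)), havg,
    fun t => (hbd t).sub (hbd (t - 1)), fun t ht => ?_⟩
  obtain ⟨g', hg, hg'⟩ := h.exists_deriv_timeAvg hV hΛ hM ht
  exact ⟨g', hg, hg', (hV.mul (continuous_timeAvg_space hc h.continuous_time hM t)).add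
    ((hc t).sub (hc (t - 1))), ⟨_, havg t⟩,
    ⟨_, ((havg t).bounded_mul hΛ).add ((hbd t).sub (hbd (t - 1)))⟩⟩

/-- A solution decaying backward in time vanishes if its double time average vanishes at time `0` on
a sufficiently fine grid. -/
theorem eq_zero_of_grid (h : IsPointwiseSolution V u ux uxx) (hV : Continuous V)
    {Λ R ℓ a C : ℝ} (hΛ : ∀ x, |V x| ≤ Λ) (ha : 0 < a)
    (hC : ∀ t x, |u t x| ≤ C * Real.exp (a * min t 0)) (hℓ : 0 ≤ ℓ)
    (hs : 4 * (Λ + a / 4) * ℓ ^ 2 ≤ 1) {n : ℕ} (hn : n * ℓ = 2 * R)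
    (hVR : ∀ x, R ≤ |x| → |V x| ≤ a / 4)
    (hzero : ∀ j ≤ n, timeAvg (clampAvg u) 0 (-R + j * ℓ) = 0) :
    ∀ t ≤ 0, ∀ x, u t x = 0 := by
  have hC0 : 0 ≤ C := nonneg_of_mul_nonneg_left ((abs_nonneg _).trans (hC 0 0)) (Real.exp_pos _)
  have hM : ∀ t x, |u t x| ≤ C := fun t x =>
    (hC t x).trans (mul_le_of_le_one_right hC0 (exp_mul_min_le_one ha.le t))
  obtain ⟨wx, wxx, hw⟩ := h.exists_clampAvg hV hΛ hM
  have hwC : ∀ t x, |clampAvg u t x| ≤ C * Real.exp (a * min t 0) := fun t x =>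
    abs_clampAvg_le ha.le (hC · x) t
  have hσ : 0 < Real.sqrt a / 4 := by positivity
  have hσa : (Real.sqrt a / 4) ^ 2 = a / 16 := by
    rw [div_pow, Real.sq_sqrt ha.le]
    norm_num
  have hcl : ∀ t, clampAvg u (min t 0) = clampAvg u t := fun t => by
    ext x
    simp [clampAvg]
  obtain ⟨D, hD⟩ := hw.exists_abs_le_exp
    (continuous_uncurry_clampAvg h.continuous_space h.continuous_time hM) ha hσ hσa hVR hwC hcl
  have e4 : a / 2 / 2 = a / 4 := by ring
  have hY := (hw.isExpDecaySolution_timeAvg hV hΛ (half_pos ha).le hσ hD).eq_zero_of_grid hσ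
    (half_pos ha) hV hΛ hℓ (by rwa [e4]) hn (by rwa [e4]) hzero
  intro t ht x
  refine eq_zero_of_timeAvg_eq_zero ha (h.continuous_time x) (hC · x) (fun s hs => ?_) t ht
  rw [← clampAvg_of_nonpos hs]
  exact eq_zero_of_timeAvg_eq_zero ha (hw.continuous_time x) (hwC · x) (fun r hr => hY r hr x) s hs

end IsPointwiseSolution

/-- The solutions on `t ≤ 0` of `∂u/∂t = ∂²u/∂x² - 2 f u` that are `O(exp (a t))` uniformly in
space. -/
def backwardSolutions (f : ℝ → ℝ) (a : ℝ) : Submodule ℝ (ℝ → ℝ → ℝ) where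
  carrier := {u | (∀ t ≤ 0, ContDiff ℝ 2 (u t)) ∧
    (∀ x, ∀ t ≤ 0, HasDerivWithinAt (fun s => u s x)
      (deriv (deriv (u t)) x - 2 * f x * u t x) (Iic 0) t) ∧
    ∃ C : ℝ, ∀ t ≤ 0, ∀ x, Real.exp (-a * t) * |u t x| ≤ C}
  zero_mem' := by
    refine ⟨fun t _ => contDiff_const, fun x t _ => ?_, 0, fun t _ x => by simp⟩
    have : deriv ((0 : ℝ → ℝ → ℝ) t) = 0 := by
      ext y
      exact deriv_const y 0
    rw [this]
    have h2 : deriv (0 : ℝ → ℝ) x = 0 := deriv_const x 0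
    simpa [h2] using hasDerivWithinAt_const t (Iic 0) (0 : ℝ)
  add_mem' := by
    rintro u v ⟨hu, hu', C, hC⟩ ⟨hv, hv', C', hC'⟩
    refine ⟨fun t ht => (hu t ht).add (hv t ht), fun x t ht => ?_, C + C', fun t ht x => ?_⟩
    · have d1 : deriv ((u + v) t) = deriv (u t) + deriv (v t) := by
        ext y
        exact deriv_add ((hu t ht).differentiable two_ne_zero y)
          ((hv t ht).differentiable two_ne_zero y)
      have d2 : deriv (deriv ((u + v) t)) x = deriv (deriv (u t)) x + deriv (deriv (v t)) x := by
        rw [d1]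
        exact deriv_add ((hu t ht).differentiable_deriv_two x)
          ((hv t ht).differentiable_deriv_two x)
      refine ((hu' x t ht).add (hv' x t ht)).congr_deriv ?_
      rw [d2]
      simp only [Pi.add_apply]
      ring
    · refine le_trans ?_ (add_le_add (hC t ht x) (hC' t ht x))
      rw [← mul_add]
      exact mul_le_mul_of_nonneg_left (abs_add_le _ _) (Real.exp_pos _).le
  smul_mem' := by
    rintro c u ⟨hu, hu', C, hC⟩
    refine ⟨fun t ht => (hu t ht).const_smul c, fun x t ht => ?_, |c| * C, fun t ht x => ?_⟩
    · have d1 : deriv ((c • u) t) = c • deriv (u t) := by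
        ext y
        exact deriv_const_smul c ((hu t ht).differentiable two_ne_zero y)
      have d2 : deriv (deriv ((c • u) t)) x = c * deriv (deriv (u t)) x := by
        rw [d1]
        exact deriv_const_smul c ((hu t ht).differentiable_deriv_two x)
      refine ((hu' x t ht).const_mul c).congr_deriv ?_
      rw [d2]
      simp only [Pi.smul_apply, smul_eq_mul]
      ring
    · simp only [Pi.smul_apply, smul_eq_mul, abs_mul]
      rw [mul_left_comm]
      exact mul_le_mul_of_nonneg_left (hC t ht x) (abs_nonneg c)

theorem continuous_min_of_mem_backwardSolutions {f : ℝ → ℝ} {a : ℝ} {u : ℝ → ℝ → ℝ}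
    (hu : u ∈ backwardSolutions f a) (x : ℝ) : Continuous fun t => u (min t 0) x := by
  have hc : ContinuousOn (fun s => u s x) (Iic 0) := fun t ht =>
    (hu.2.1 x t ht).continuousWithinAt
  exact hc.comp_continuous (by fun_prop) fun t => min_le_right t 0

theorem isPointwiseSolution_of_mem_backwardSolutions {f : ℝ → ℝ} {a : ℝ} {u : ℝ → ℝ → ℝ}
    (hu : u ∈ backwardSolutions f a) :
    IsPointwiseSolution (fun x => 2 * f x) (fun t => u (min t 0)) (fun t => deriv (u (min t 0)))
      fun t => deriv (deriv (u (min t 0))) where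
  continuous_time := continuous_min_of_mem_backwardSolutions hu
  hasDerivAt_space t x :=
    ((hu.1 _ (min_le_right t 0)).differentiable two_ne_zero x).hasDerivAt
  hasDerivAt_space' t x := ((hu.1 _ (min_le_right t 0)).differentiable_deriv_two x).hasDerivAt
  continuous_uxx t := by
    have := (hu.1 _ (min_le_right t 0)).continuous_iteratedDeriv 2 le_rfl
    rwa [iteratedDeriv_succ, iteratedDeriv_one] at this
  hasDerivAt_time t ht x := by
    have h1 := (hu.2.1 x t ht.le).hasDerivAt (Iic_mem_nhds ht)
    simp only [min_eq_left ht.le]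
    refine h1.congr_of_eventuallyEq ?_
    filter_upwards [Iio_mem_nhds ht] with s hs
    rw [min_eq_left (le_of_lt hs)]

/-- The linear map evaluating the double time average at time `0` at finitely many points. -/
noncomputable def gridEval (f : ℝ → ℝ) (a : ℝ) {n : ℕ} (p : Fin n → ℝ) :
    backwardSolutions f a →ₗ[ℝ] Fin n → ℝ where
  toFun u j := timeAvg (clampAvg fun t => u.1 (min t 0)) 0 (p j)
  map_add' u v := by
    have hu := continuous_min_of_mem_backwardSolutions u.2
    have hv := continuous_min_of_mem_backwardSolutions v.2
    have h1 : ∀ x, Continuous fun t => clampAvg (fun t => u.1 (min t 0)) t x := fun x =>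
      (continuous_timeAvg_time (hu x)).comp (by fun_prop : Continuous fun t : ℝ => min t 0)
    have h2 : ∀ x, Continuous fun t => clampAvg (fun t => v.1 (min t 0)) t x := fun x =>
      (continuous_timeAvg_time (hv x)).comp (by fun_prop : Continuous fun t : ℝ => min t 0)
    ext j
    simp only [Pi.add_apply, timeAvg]
    rw [← intervalIntegral.integral_add ((h1 _).intervalIntegrable _ _)
      ((h2 _).intervalIntegrable _ _)]
    congr 1
    ext s
    simp only [clampAvg, timeAvg]
    rw [← intervalIntegral.integral_add ((hu _).intervalIntegrable _ _)
      ((hv _).intervalIntegrable _ _)]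
    rfl
  map_smul' c u := by
    ext j
    simp only [Pi.smul_apply, smul_eq_mul, RingHom.id_apply, timeAvg, clampAvg, Submodule.coe_smul,
      intervalIntegral.integral_const_mul]

/-- finite dimensionality of the space of exponentially decaying backward
solutions of the linearized equation `∂u/∂t = ∂²u/∂x² − 2 f(x) u` about an equilibrium
`f` of `f'' − f² + φ = 0`.  For every `a > 0`, the set `S_a` spans a finite-dimensional
real vector space. -/
theorem stmt19 (φ : ℝ → ℝ) (hφ : ContDiff ℝ (⊤ : ℕ∞) φ)
    (hφtop : Tendsto φ atTop (nhds 0)) (hφbot : Tendsto φ atBot (nhds 0))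
    (f : ℝ → ℝ) (hf : ContDiff ℝ 2 f)
    (hfbd : ∃ C : ℝ, ∀ x : ℝ, |f x| ≤ C)
    (hfeq : ∀ x : ℝ, deriv (deriv f) x - f x ^ 2 + φ x = 0)
    (hftop : Tendsto f atTop (nhds 0)) (hfbot : Tendsto f atBot (nhds 0)) :
    ∀ a : ℝ, 0 < a →
      ∃ (m : ℕ) (v : Fin m → ℝ → ℝ → ℝ),
        ∀ u : ℝ → ℝ → ℝ,
          -- `u` is twice continuously differentiable in `x`
          (∀ t : ℝ, t ≤ 0 → ContDiff ℝ 2 (u t)) →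
          -- `u` is differentiable in `t` on `(−∞,0]` and solves the linearized equation
          (∀ x : ℝ, ∀ t : ℝ, t ≤ 0 →
            HasDerivWithinAt (fun s : ℝ => u s x)
              (deriv (deriv (u t)) x - 2 * f x * u t x) (Iic 0) t) →
          -- `sup_{t ≤ 0, x} e^{−a t} |u(t,x)| < ∞`
          (∃ C : ℝ, ∀ t : ℝ, t ≤ 0 → ∀ x : ℝ, Real.exp (-a * t) * |u t x| ≤ C) →
          -- then `u` is a linear combination of `v₁, …, v_m` on `(−∞,0] × ℝ`
          ∃ c : Fin m → ℝ, ∀ t : ℝ, t ≤ 0 → ∀ x : ℝ, u t x = ∑ i : Fin m, c i * v i t x := by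
  intro a ha
  obtain ⟨C, hC⟩ := hfbd
  have hV : Continuous fun x => 2 * f x := continuous_const.mul hf.continuous
  have hΛ : ∀ x, |2 * f x| ≤ 2 * C := fun x => by
    rw [abs_mul, abs_two]
    exact mul_le_mul_of_nonneg_left (hC x) two_pos.le
  obtain ⟨R, hR, hVR⟩ : ∃ R, 0 ≤ R ∧ ∀ x, R ≤ |x| → |2 * f x| ≤ a / 4 := by
    have hlim : ∀ {l : Filter ℝ}, Tendsto f l (nhds 0) → ∀ᶠ x in l, |2 * f x| ≤ a / 4 := by
      intro l hl
      have : Tendsto (fun x => |2 * f x|) l (nhds 0) := by simpa using (hl.const_mul 2).abs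
      exact (this.eventually (gt_mem_nhds (by positivity : 0 < a / 4))).mono fun _ => le_of_lt
    obtain ⟨r, hr⟩ := eventually_atTop.1 (hlim hftop)
    obtain ⟨s, hs⟩ := eventually_atBot.1 (hlim hfbot)
    refine ⟨max (max r (-s)) 0, le_max_right _ _, fun x hx => ?_⟩
    simp only [max_le_iff] at hx
    rcases le_abs'.1 hx.1.1 with h | h
    · rcases le_abs'.1 hx.1.2 with h' | h'
      · exact hs x (by linarith)
      · rcases abs_cases x with h2 | h2
        · exact hr x (by linarith [hx.1.1])
        · exact hs x (by linarith [hx.1.2])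
    · exact hr x h
  obtain ⟨n, hn0, hn⟩ : ∃ n : ℕ, 0 < n ∧ 4 * (2 * C + a / 4) * (2 * R / n) ^ 2 ≤ 1 := by
    have hlim : Tendsto (fun n : ℕ => 4 * (2 * C + a / 4) * (2 * R / n) ^ 2) atTop (nhds 0) := by
      simpa using ((tendsto_const_div_atTop_nhds_zero_nat (2 * R)).pow 2).const_mul
        (4 * (2 * C + a / 4))
    obtain ⟨n, h1, h2⟩ := ((eventually_gt_atTop 0).and
      (hlim.eventually (gt_mem_nhds one_pos))).exists
    exact ⟨n, h1, h2.le⟩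
  have hnℓ : n * (2 * R / n) = 2 * R := mul_div_cancel₀ _ (by positivity)
  let L := gridEval f a fun j : Fin (n + 1) => -R + (j : ℕ) * (2 * R / n)
  have hker : ∀ w : backwardSolutions f a, L w = 0 → ∀ t ≤ 0, ∀ x, w.1 t x = 0 := by
    intro w hw t ht x
    obtain ⟨K, hK⟩ := w.2.2.2
    have hwK : ∀ t x, |w.1 (min t 0) x| ≤ K * Real.exp (a * min t 0) := fun t x => by
      have h1 := mul_le_mul_of_nonneg_right (hK _ (min_le_right t 0) x)
        (Real.exp_pos (a * min t 0)).le
      rwa [mul_right_comm, ← Real.exp_add, neg_mul, neg_add_cancel, Real.exp_zero, one_mul] at h1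
    have := (isPointwiseSolution_of_mem_backwardSolutions w.2).eq_zero_of_grid hV hΛ ha hwK
      (by positivity) hn hnℓ hVR
      (fun j hj => congrFun hw ⟨j, Nat.lt_succ_of_le hj⟩) t ht x
    rwa [min_eq_left ht] at this
  let b := Module.finBasis ℝ (LinearMap.range L)
  choose v hv using fun i => LinearMap.mem_range.1 (b i).2
  refine ⟨_, fun i => (v i).1, fun u h1 h2 h3 => ?_⟩
  let U : backwardSolutions f a := ⟨u, h1, h2, h3⟩
  let y : LinearMap.range L := ⟨L U, LinearMap.mem_range_self L U⟩
  refine ⟨b.repr y, fun t ht x => ?_⟩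
  have hzero : L (U - ∑ i, b.repr y i • v i) = 0 := by
    have h4 := congrArg Subtype.val (b.sum_repr y)
    simp only [Submodule.coe_sum, Submodule.coe_smul] at h4
    simp only [map_sub, map_sum, map_smul, hv]
    rw [h4, sub_self]
  have h5 := hker _ hzero t ht x
  simpa [sub_eq_zero, U, Finset.sum_apply] using h5
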